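/- (Generalized Strassen theorem.) Let a, b, c be integers with 2 < a ≤ b ≤ c, and let V = ℂ^{a+1} ⊗ ℂ^{b+1} ⊗ ℂ^{c+1} carry the Segre of ℙ^a × ℙ^b × ℙ^c. Let k be a positive integer with k ≤ (a+1)(b+1)(c+1)/(a+b+c+1) − c − 1. Then the general linear subspace of V of dimension (a+1)(b+1)(c+1) − (a+b+2) (i.e., of codimension a+b+2) which is tangent to the Segre at k general points is tangent only at those points. -/

import Mathlib

open scoped TensorProduct
open PiTensorProduct

noncomputable section

/-- The space of tensors `V = ℂ^{a₁+1} ⊗ ⋯ ⊗ ℂ^{a_q+1}`. -/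
abbrev Ten (q : ℕ) (a : Fin q → ℕ) : Type :=
  ⨂[ℂ] i : Fin q, (Fin (a i + 1) → ℂ)

/-- Index type for the coordinates on the parameter space `W_k`. -/
abbrev WIdx (q : ℕ) (a : Fin q → ℕ) (k : ℕ) : Type :=
  Fin k × Σ j : Fin q, Fin (a j + 1)

/-- Index type for the standard (decomposable) basis of `Ten q a`. -/
abbrev BIdx (q : ℕ) (a : Fin q → ℕ) : Type := ∀ j : Fin q, Fin (a j + 1)

/-- A tensor is decomposable if it is `v₁ ⊗ ⋯ ⊗ v_q` with all `vᵢ ≠ 0`. -/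
def IsDecomposable {q : ℕ} {a : Fin q → ℕ} (t : Ten q a) : Prop :=
  ∃ v : ∀ j : Fin q, Fin (a j + 1) → ℂ, (∀ j, v j ≠ 0) ∧ t = tprod ℂ v

/-- The affine tangent space at `v₁ ⊗ ⋯ ⊗ v_q` to the cone over the Segre variety:
the span of all tensors obtained by replacing one factor of `v` by an arbitrary vector. -/
def tangent {q : ℕ} (a : Fin q → ℕ) (v : ∀ j : Fin q, Fin (a j + 1) → ℂ) :
    Submodule ℂ (Ten q a) :=
  Submodule.span ℂ
    {x | ∃ (j : Fin q) (u : Fin (a j + 1) → ℂ), x = tprod ℂ (Function.update v j u)}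

/-- The map `Φ : W_k → V` sending a `k`-tuple of factor vectors to the sum of the
corresponding decomposable tensors. -/
def Phi {q : ℕ} (a : Fin q → ℕ) {k : ℕ}
    (p : Fin k → ∀ j : Fin q, Fin (a j + 1) → ℂ) : Ten q a :=
  ∑ i, tprod ℂ (p i)

/-- Evaluation of a polynomial function on `W_k` at a parameter point. -/
def evalW {q : ℕ} {a : Fin q → ℕ} {k : ℕ}
    (F : MvPolynomial (WIdx q a k) ℂ)
    (p : Fin k → ∀ j : Fin q, Fin (a j + 1) → ℂ) : ℂ :=
  MvPolynomial.eval (fun x => p x.1 x.2.1 x.2.2) F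

/-- `k`-identifiability of the Segre product `ℙ^{a₁} × ⋯ × ℙ^{a_q}`:
there is a nonzero polynomial function `F` on `W_k` such that whenever `F(p) ≠ 0`,
the tensor `Φ(p)` has a rank-`k` decomposition, and any two rank-`k` decompositions
of `Φ(p)` agree as multisets of decomposable tensors. -/
def Identifiable (q : ℕ) (a : Fin q → ℕ) (k : ℕ) : Prop :=
  ∃ F : MvPolynomial (WIdx q a k) ℂ,
    (∃ p, evalW F p ≠ 0) ∧
    ∀ p, evalW F p ≠ 0 →
      ((∃ t : Fin k → Ten q a, (∀ i, IsDecomposable (t i)) ∧ ∑ i, t i = Phi a p) ∧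
       ∀ s t : Fin k → Ten q a,
         (∀ i, IsDecomposable (s i)) → (∀ i, IsDecomposable (t i)) →
         ∑ i, s i = Phi a p → ∑ i, t i = Phi a p →
         Finset.univ.val.map s = Finset.univ.val.map t)

/-- The standard decomposable basis vector of `Ten q a` indexed by `f`. -/
def basisVec {q : ℕ} (a : Fin q → ℕ) (f : BIdx q a) : Ten q a :=
  tprod ℂ fun j => Pi.single (f j) 1

/-- The vector of `Ten q a` with coordinates `c` in the standard basis. -/
def fromCoords {q : ℕ} (a : Fin q → ℕ) (c : BIdx q a → ℂ) : Ten q a :=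
  ∑ f : BIdx q a, c f • basisVec a f

/-- Evaluation of a polynomial function on `W_k × V^e` at a parameter point. -/
def evalWV {q : ℕ} {a : Fin q → ℕ} {k e : ℕ}
    (F : MvPolynomial (WIdx q a k ⊕ (Fin e × BIdx q a)) ℂ)
    (p : Fin k → ∀ j : Fin q, Fin (a j + 1) → ℂ)
    (c : Fin e → BIdx q a → ℂ) : ℂ :=
  MvPolynomial.eval (Sum.elim (fun x => p x.1 x.2.1 x.2.2) (fun y => c y.1 y.2)) F

/-- `TangentGeneral q a k d` says: the general linear subspace of `V` of dimension `d`
which is tangent to the Segre at `k` general points is tangent only at those points.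
Concretely, with `e = d - k(1 + Σᵢ aᵢ)`, there is a nonzero polynomial function `F` on
`W_k × V^e` such that whenever `F ≠ 0` at `(p, c)`, the space `L` spanned by the tangent
spaces at the `k` decomposable tensors determined by `p` together with the `e` extra
vectors determined by `c` has dimension exactly `d`, and any decomposable tensor whose
tangent space lies in `L` is a scalar multiple of one of the `k` given ones. -/
def TangentGeneral (q : ℕ) (a : Fin q → ℕ) (k d : ℕ) : Prop :=
  ∃ F : MvPolynomial (WIdx q a k ⊕ (Fin (d - k * (1 + ∑ j, a j)) × BIdx q a)) ℂ,
    (∃ p c, evalWV F p c ≠ 0) ∧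
    ∀ p c, evalWV F p c ≠ 0 →
      (Module.finrank ℂ
          ↥((⨆ i, tangent a (p i)) ⊔
            Submodule.span ℂ (Set.range fun m => fromCoords a (c m))) = d ∧
       ∀ w : ∀ j : Fin q, Fin (a j + 1) → ℂ, (∀ j, w j ≠ 0) →
         tangent a w ≤
           (⨆ i, tangent a (p i)) ⊔
             Submodule.span ℂ (Set.range fun m => fromCoords a (c m)) →
         ∃ (i : Fin k) (t : ℂ), tprod ℂ w = t • tprod ℂ (p i))

namespace SegreTangent

open MvPolynomial

section Generic

variable {σ τ : Type*}

/-- A function of finitely many complex coordinates which is given by a polynomial. -/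
def PolyFun (f : (σ → ℂ) → ℂ) : Prop := ∃ P : MvPolynomial σ ℂ, ∀ s, eval s P = f s

lemma PolyFun.const (r : ℂ) : PolyFun (fun _ : σ → ℂ => r) := ⟨C r, fun s => by simp⟩

lemma PolyFun.coord (i : σ) : PolyFun (fun s : σ → ℂ => s i) := ⟨X i, fun s => by simp⟩

lemma PolyFun.add {f g : (σ → ℂ) → ℂ} (hf : PolyFun f) (hg : PolyFun g) :
    PolyFun (fun s => f s + g s) := by
  obtain ⟨P, hP⟩ := hf
  obtain ⟨Q, hQ⟩ := hg
  exact ⟨P + Q, fun s => by simp [hP, hQ]⟩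

lemma PolyFun.mul {f g : (σ → ℂ) → ℂ} (hf : PolyFun f) (hg : PolyFun g) :
    PolyFun (fun s => f s * g s) := by
  obtain ⟨P, hP⟩ := hf
  obtain ⟨Q, hQ⟩ := hg
  exact ⟨P * Q, fun s => by simp [hP, hQ]⟩

lemma PolyFun.sub {f g : (σ → ℂ) → ℂ} (hf : PolyFun f) (hg : PolyFun g) :
    PolyFun (fun s => f s - g s) := by
  obtain ⟨P, hP⟩ := hf
  obtain ⟨Q, hQ⟩ := hg
  exact ⟨P - Q, fun s => by simp [hP, hQ]⟩

lemma PolyFun.sum {ι : Type*} (t : Finset ι) {f : ι → (σ → ℂ) → ℂ}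
    (hf : ∀ i ∈ t, PolyFun (f i)) : PolyFun (fun s => ∑ i ∈ t, f i s) := by
  classical
  induction t using Finset.induction_on with
  | empty => simpa using PolyFun.const 0
  | insert i t hi ih =>
    simp only [Finset.sum_insert hi]
    exact (hf i (Finset.mem_insert_self _ _)).add
      (ih fun j hj => hf j (Finset.mem_insert_of_mem hj))

lemma PolyFun.ite {p : Prop} [Decidable p] {f g : (σ → ℂ) → ℂ} (hf : PolyFun f)
    (hg : PolyFun g) : PolyFun (fun s => if p then f s else g s) := by
  split_ifs <;> assumption

/-- A property of points of affine space which holds off the zero locus of some nonzero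
polynomial. -/
def Gen (P : (σ → ℂ) → Prop) : Prop :=
  ∃ F : MvPolynomial σ ℂ, F ≠ 0 ∧ ∀ s, eval s F ≠ 0 → P s

lemma exists_eval_ne_zero {F : MvPolynomial σ ℂ} (hF : F ≠ 0) : ∃ s, eval s F ≠ 0 := by
  by_contra! h
  exact hF (MvPolynomial.funext fun s => by simp [h s])

lemma Gen.exists {P : (σ → ℂ) → Prop} (h : Gen P) : ∃ s, P s := by
  obtain ⟨F, hF, h⟩ := h
  obtain ⟨s, hs⟩ := exists_eval_ne_zero hF
  exact ⟨s, h s hs⟩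

lemma Gen.mono {P Q : (σ → ℂ) → Prop} (h : Gen P) (hPQ : ∀ s, P s → Q s) : Gen Q := by
  obtain ⟨F, hF, h⟩ := h
  exact ⟨F, hF, fun s hs => hPQ s (h s hs)⟩

lemma Gen.of_forall {P : (σ → ℂ) → Prop} (h : ∀ s, P s) : Gen P :=
  ⟨1, one_ne_zero, fun s _ => h s⟩

lemma Gen.and {P Q : (σ → ℂ) → Prop} (hP : Gen P) (hQ : Gen Q) :
    Gen (fun s => P s ∧ Q s) := by
  obtain ⟨F, hF, hP⟩ := hP
  obtain ⟨G, hG, hQ⟩ := hQ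
  refine ⟨F * G, mul_ne_zero hF hG, fun s hs => ?_⟩
  rw [map_mul] at hs
  exact ⟨hP s (left_ne_zero_of_mul hs), hQ s (right_ne_zero_of_mul hs)⟩

lemma Gen.forall {ι : Type*} [Finite ι] {P : ι → (σ → ℂ) → Prop} (h : ∀ i, Gen (P i)) :
    Gen (fun s => ∀ i, P i s) := by
  cases nonempty_fintype ι
  choose F hF h using h
  refine ⟨∏ i, F i, Finset.prod_ne_zero_iff.2 fun i _ => hF i, fun s hs i => h i s ?_⟩
  rw [map_prod] at hs
  exact Finset.prod_ne_zero_iff.1 hs i (Finset.mem_univ i)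

lemma Gen.comap {P : (σ → ℂ) → Prop} (h : Gen P) (f : σ → τ) (hf : Function.Injective f) :
    Gen (fun s : τ → ℂ => P (fun i => s (f i))) := by
  obtain ⟨F, hF, h⟩ := h
  refine ⟨rename f F, fun h0 => hF (rename_injective f hf (by simpa using h0)),
    fun s hs => h _ ?_⟩
  rwa [eval_rename] at hs

lemma PolyFun.gen_ne_zero {f : (σ → ℂ) → ℂ} (hf : PolyFun f) (s₀ : σ → ℂ) (h : f s₀ ≠ 0) :
    Gen (fun s => f s ≠ 0) := by
  obtain ⟨P, hP⟩ := hf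
  refine ⟨P, ?_, fun s hs => by simpa only [← hP] using hs⟩
  rintro rfl
  exact h (by rw [← hP]; simp)

/-- Injectivity of a linear map depending polynomially on parameters is generic as soon as it
holds at one point. -/
lemma Gen.injective {K κ : Type*} [AddCommGroup K] [Module ℂ K] [FiniteDimensional ℂ K]
    [Finite κ] (Λ : (σ → ℂ) → K →ₗ[ℂ] (κ → ℂ)) (hΛ : ∀ u j, PolyFun (fun s => Λ s u j))
    (s₀ : σ → ℂ) (h : ∀ u, Λ s₀ u = 0 → u = 0) : Gen (fun s => ∀ u, Λ s u = 0 → u = 0) := by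
  classical
  cases nonempty_fintype κ
  obtain ⟨N, hN⟩ := (Λ s₀).exists_leftInverse_of_injective (LinearMap.ker_eq_bot'.2 h)
  let b := Module.finBasis ℂ K
  have hP : PolyFun (fun s => LinearMap.det (N ∘ₗ Λ s)) := by
    choose P hP using fun i j => hΛ (b i) j
    refine ⟨Matrix.det (Matrix.of fun i j => ∑ m, C (b.repr (N (Pi.single m 1)) i) * P j m),
      fun s => ?_⟩
    change _ = LinearMap.det (N ∘ₗ Λ s)
    rw [← LinearMap.det_toMatrix b, RingHom.map_det]
    congr 1
    ext i j
    have hexp : Λ s (b j) = ∑ m, Λ s (b j) m • (Pi.single m (1 : ℂ) : κ → ℂ) := by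
      ext m
      simp [Finset.sum_apply, Pi.single_apply]
    rw [LinearMap.toMatrix_apply, LinearMap.comp_apply, hexp]
    simp [hP, map_sum, mul_comm]
  refine (hP.gen_ne_zero s₀ (by simp [hN])).mono fun s hs u hu => ?_
  have hinj : Function.Injective (N ∘ₗ Λ s) :=
    ((LinearMap.isUnit_iff_isUnit_det _).2 hs.isUnit |> (Module.End.isUnit_iff _).1).1
  exact hinj (by simp [hu])

/-- A polynomial map from a lower-dimensional affine space misses the generic point. -/
lemma Gen.not_mem_image [Finite σ] [Finite τ] (hcard : Nat.card σ < Nat.card τ)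
    (f : (σ → ℂ) → τ → ℂ) (hf : ∀ j, PolyFun (fun s => f s j)) :
    Gen (fun t => ∀ s, f s ≠ t) := by
  cases nonempty_fintype σ
  cases nonempty_fintype τ
  choose P hP using hf
  have hdep : ¬ AlgebraicIndependent ℂ P := by
    intro h
    have := h.lift_cardinalMk_le_trdeg
    rw [MvPolynomial.trdeg_of_isDomain] at this
    simp at this
    simp at hcard
    exact_mod_cast absurd this (by simpa using hcard)
  rw [algebraicIndependent_iff] at hdep
  push Not at hdep
  obtain ⟨F, hF, hF0⟩ := hdep
  refine ⟨F, hF0, fun t ht s hst => ht ?_⟩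
  have hev : ∀ G : MvPolynomial τ ℂ, eval s (aeval P G) = eval (f s) G := fun G => by
    induction G using MvPolynomial.induction_on with
    | C r => simp
    | add p q hp hq => simp only [map_add, hp, hq]
    | mul_X p j hp => simp only [map_mul, hp, aeval_X, eval_X, hP]
  rw [← hst, ← hev, hF, map_zero]

end Generic

section Slices

/-- Coordinates of a family, indexed by `κ`, of triples of vectors. -/
abbrev Par (κ α β γ : Type*) := κ × (α ⊕ β ⊕ γ)

variable {κ α β γ : Type*}

/-- The first vectors of a family of triples. -/
def px (s : Par κ α β γ → ℂ) (i : κ) (a : α) : ℂ := s (i, .inl a)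

/-- The second vectors of a family of triples. -/
def py (s : Par κ α β γ → ℂ) (i : κ) (b : β) : ℂ := s (i, .inr (.inl b))

/-- The third vectors of a family of triples. -/
def pz (s : Par κ α β γ → ℂ) (i : κ) (m : γ) : ℂ := s (i, .inr (.inr m))

/-- The family of triples with prescribed vectors. -/
def mkPar (x : κ → α → ℂ) (y : κ → β → ℂ) (z : κ → γ → ℂ) : Par κ α β γ → ℂ :=
  fun q => Sum.elim (x q.1) (Sum.elim (y q.1) (z q.1)) q.2

@[simp] lemma px_mkPar (x : κ → α → ℂ) (y : κ → β → ℂ) (z : κ → γ → ℂ) :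
    px (mkPar x y z) = x := rfl

@[simp] lemma py_mkPar (x : κ → α → ℂ) (y : κ → β → ℂ) (z : κ → γ → ℂ) :
    py (mkPar x y z) = y := rfl

@[simp] lemma pz_mkPar (x : κ → α → ℂ) (y : κ → β → ℂ) (z : κ → γ → ℂ) :
    pz (mkPar x y z) = z := rfl

lemma PolyFun.px (i : κ) (a : α) : PolyFun (fun s : Par κ α β γ → ℂ => px s i a) := .coord _

lemma PolyFun.py (i : κ) (b : β) : PolyFun (fun s : Par κ α β γ → ℂ => py s i b) := .coord _

lemma PolyFun.pz (i : κ) (m : γ) : PolyFun (fun s : Par κ α β γ → ℂ => pz s i m) := .coord _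

lemma mul_single_mul_single [DecidableEq α] [DecidableEq β] (v : ℂ) (a a' : α) (b b' : β) :
    v * (Pi.single (M := fun _ => ℂ) a 1 a' * Pi.single (M := fun _ => ℂ) b 1 b') =
      if (a, b) = (a', b') then v else 0 := by
  by_cases ha : a = a' <;> by_cases hb : b = b' <;>
    simp [ha, hb, eq_comm (a := a'), eq_comm (a := b')]

variable [Fintype κ] [DecidableEq α] [DecidableEq β] [DecidableEq κ]

/-- For generic points, the matrices `x_j ⊗ y_j` with `j ∉ S`, together with the matrices
`x_{i₀} ⊗ e_{φ n}`, stay independent after restriction to a large enough set of entries. -/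
lemma gen_slice [Finite α] [Finite β] {r : ℕ} (S : Finset κ) (i₀ : κ) (φ : Fin r → β)
    (hφ : Function.Injective φ)
    (Ω : Finset (α × β)) (pos : κ → α × β) (hinj : Set.InjOn pos {j | j ∉ S})
    (hpos : ∀ j ∉ S, pos j ∈ Ω) (hΩ : ∀ n, ((pos i₀).1, φ n) ∈ Ω)
    (hne : ∀ j ∉ S, ∀ n, pos j ≠ ((pos i₀).1, φ n)) :
    Gen (fun s : Par κ α β γ → ℂ => ∀ (u : κ → ℂ) (w : Fin r → ℂ),
      (∀ q ∈ Ω, ∑ j, (if j ∈ S then 0 else u j * (px s j q.1 * py s j q.2)) +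
        ∑ n, w n * (px s i₀ q.1 * Pi.single (M := fun _ => ℂ) (φ n) 1 q.2) = 0) →
      (∀ j ∉ S, u j = 0) ∧ w = 0) := by
  classical
  cases nonempty_fintype α
  cases nonempty_fintype β
  let Λ (s : Par κ α β γ → ℂ) : ({j // j ∉ S} → ℂ) × (Fin r → ℂ) →ₗ[ℂ] (Ω → ℂ) :=
    { toFun := fun v q => ∑ j, v.1 j * (px s j q.1.1 * py s j q.1.2) +
        ∑ n, v.2 n * (px s i₀ q.1.1 * Pi.single (M := fun _ => ℂ) (φ n) 1 q.1.2)
      map_add' := fun v v' => by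
        ext q
        simp only [Prod.fst_add, Prod.snd_add, Pi.add_apply, add_mul, Finset.sum_add_distrib]
        ring
      map_smul' := fun c v => by
        ext q
        simp only [Prod.smul_fst, Prod.smul_snd, Pi.smul_apply, smul_eq_mul, mul_add,
          Finset.mul_sum, mul_assoc, RingHom.id_apply] }
  have hΛ : Gen (fun s => ∀ v, Λ s v = 0 → v = 0) := by
    refine Gen.injective Λ (fun v q => ?_)
      (mkPar (fun j => Pi.single (pos j).1 1) (fun j => Pi.single (pos j).2 1) 0) ?_
    · exact (PolyFun.sum _ fun j _ => (PolyFun.const _).mul ((PolyFun.px _ _).mul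
        (PolyFun.py _ _))).add (PolyFun.sum _ fun n _ => (PolyFun.const _).mul
          ((PolyFun.px _ _).mul (PolyFun.const _)))
    · rintro ⟨u, w⟩ h
      have key (q) (hq : q ∈ Ω) : ∑ j : {j // j ∉ S}, (if pos j = q then u j else 0) +
          ∑ n, (if ((pos i₀).1, φ n) = q then w n else 0) = 0 := by
        have := congrFun h ⟨q, hq⟩
        simpa only [Λ, LinearMap.coe_mk, AddHom.coe_mk, px_mkPar, py_mkPar, Pi.zero_apply,
          mul_single_mul_single] using this
      refine Prod.ext (funext fun j => ?_) (funext fun n => ?_)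
      · have := key _ (hpos j j.2)
        rw [Finset.sum_eq_single j, Finset.sum_eq_zero] at this
        · simpa using this
        · intro n _
          rw [if_neg fun h => hne j j.2 n h.symm]
        · intro j' _ hj'
          rw [if_neg fun h => hj' (Subtype.ext (hinj j'.2 j.2 h))]
        · simp
      · have := key _ (hΩ n)
        rw [Finset.sum_eq_zero, Finset.sum_eq_single n] at this
        · simpa using this
        · intro n' _ hn
          rw [if_neg fun h => hn (hφ (Prod.ext_iff.1 h).2)]
        · simp
        · intro j _
          rw [if_neg (hne j j.2 n)]
  refine hΛ.mono fun s hs u w h => ?_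
  have := hs (fun j => u j, w) (funext fun q => by
    have := h q q.2
    rw [Finset.sum_ite, Finset.sum_const_zero, zero_add,
      Finset.sum_subtype (Finset.univ.filter (· ∉ S)) (p := (· ∉ S)) (by simp)] at this
    exact this)
  obtain ⟨h1, h2⟩ := Prod.ext_iff.1 this
  exact ⟨fun j hj => congrFun h1 ⟨j, hj⟩, h2⟩

end Slices

section Slices

lemma card_fin_Ico {n lo hi : ℕ} (h : hi ≤ n) :
    (Finset.univ.filter fun i : Fin n => lo ≤ i.1 ∧ i.1 < hi).card = hi - lo := by
  rw [← Nat.card_Ico lo hi, ← Finset.card_map Fin.valEmbedding]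
  congr 1
  ext i
  simp only [Finset.mem_map, Finset.mem_filter, Finset.mem_univ, true_and, Fin.valEmbedding_apply,
    Finset.mem_Ico]
  exact ⟨by rintro ⟨j, hj, rfl⟩; exact hj, fun hi' => ⟨⟨i, by omega⟩, hi', rfl⟩⟩

/-- The entries of an `A × B` matrix lying outside the leading `t × t` block, with a coordinate
smaller than `t` only allowed if it lies in `[lo, hi)`. -/
def blockSupp (A B t lo hi : ℕ) : Finset (Fin A × Fin B) :=
  Finset.univ.filter fun q => (t ≤ q.1.1 ∧ t ≤ q.2.1) ∨ (lo ≤ q.1.1 ∧ q.1.1 < hi ∧ t ≤ q.2.1) ∨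
    (t ≤ q.1.1 ∧ lo ≤ q.2.1 ∧ q.2.1 < hi)

lemma card_blockSupp {A B t lo hi : ℕ} (hA : t ≤ A) (hB : t ≤ B) (hhi : hi ≤ t) :
    (A - t) * (B - t) + (hi - lo) * (A - t + (B - t)) ≤ (blockSupp A B t lo hi).card := by
  let F (n l h : ℕ) : Finset (Fin n) := Finset.univ.filter fun i => l ≤ i.1 ∧ i.1 < h
  have h1 : F A t A ×ˢ F B t B ∪ (F A lo hi ×ˢ F B t B ∪ F A t A ×ˢ F B lo hi) ⊆
      blockSupp A B t lo hi := by
    intro q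
    simp only [F, blockSupp, Finset.mem_union, Finset.mem_product, Finset.mem_filter,
      Finset.mem_univ, true_and]
    omega
  refine le_trans (le_of_eq ?_) (Finset.card_le_card h1)
  rw [Finset.card_union_of_disjoint, Finset.card_union_of_disjoint]
  · simp only [Finset.card_product, F, card_fin_Ico le_rfl, card_fin_Ico (hhi.trans hA),
      card_fin_Ico (hhi.trans hB)]
    ring
  · rw [Finset.disjoint_left]
    intro q
    simp only [F, Finset.mem_product, Finset.mem_filter, Finset.mem_univ, true_and]
    omega
  · rw [Finset.disjoint_left]
    intro q
    simp only [F, Finset.mem_union, Finset.mem_product, Finset.mem_filter, Finset.mem_univ,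
      true_and]
    omega

lemma gen_blockSupp {γ : Type*} {k A B r t lo hi : ℕ} (S : Finset (Fin k)) (hS : S.card = t)
    (i₀ : Fin k) (φ : Fin r → Fin B) (hφ : Function.Injective φ) (hφt : ∀ n, t < (φ n).1)
    (hA : t < A) (hB : t < B) (hhi : hi ≤ t) (hi₀ : r = 0 ∨ i₀ ∉ S)
    (hcard : k + r ≤ (A - t) * (B - t) + (hi - lo) * (A - t + (B - t)) + t) :
    Gen (fun s : Par (Fin k) (Fin A) (Fin B) γ → ℂ => ∀ (u : Fin k → ℂ) (w : Fin r → ℂ),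
      (∀ q ∈ blockSupp A B t lo hi,
        ∑ j, (if j ∈ S then 0 else u j * (px s j q.1 * py s j q.2)) +
        ∑ n, w n * (px s i₀ q.1 * Pi.single (M := fun _ => ℂ) (φ n) 1 q.2) = 0) →
      (∀ j ∉ S, u j = 0) ∧ w = 0) := by
  classical
  let last : Fin A := ⟨A - 1, by omega⟩
  let R : Finset (Fin A × Fin B) := Finset.univ.image fun n => (last, φ n)
  have hR : R.card = r := by
    rw [Finset.card_image_of_injective _ fun n n' h => hφ (Prod.ext_iff.1 h).2]
    simp
  have hRsub : R ⊆ blockSupp A B t lo hi := by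
    intro q hq
    obtain ⟨n, -, rfl⟩ := Finset.mem_image.1 hq
    have := hφt n
    simp only [blockSupp, Finset.mem_filter, Finset.mem_univ, true_and, last]
    omega
  let Ω' := blockSupp A B t lo hi \ R
  have hΩ' : Sᶜ.card ≤ Ω'.card := by
    have := card_blockSupp (lo := lo) hA.le hB.le hhi
    rw [Finset.card_sdiff_of_subset hRsub, Finset.card_compl, hR, hS, Fintype.card_fin]
    omega
  have hcorner : (last, ⟨t, hB⟩) ∈ Ω' := by
    simp only [Ω', R, blockSupp, Finset.mem_sdiff, Finset.mem_filter, Finset.mem_univ, true_and,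
      Finset.mem_image, last, not_exists, Prod.mk.injEq]
    refine ⟨by omega, fun n h => ?_⟩
    have := hφt n
    rw [h] at this
    exact lt_irrefl _ this
  obtain ⟨e⟩ : Nonempty ({j // j ∈ Sᶜ} ↪ {q // q ∈ Ω'}) :=
    Function.Embedding.nonempty_of_card_le (by rwa [Fintype.card_coe, Fintype.card_coe])
  let g (j : Fin k) : Fin A × Fin B := if h : j ∈ Sᶜ then (e ⟨j, h⟩).1 else (last, ⟨t, hB⟩)
  have hg (j) (hj : j ∉ S) : g j ∈ Ω' := by
    simp only [g, Finset.mem_compl, hj, not_false_eq_true, dif_pos]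
    exact (e _).2
  have hginj : Set.InjOn g {j | j ∉ S} := by
    intro j hj j' hj' h
    change j ∉ S at hj
    change j' ∉ S at hj'
    simp only [g, Finset.mem_compl, hj, hj', not_false_eq_true, dif_pos] at h
    simpa using e.injective (Subtype.ext h)
  have hne (q) (hq : q ∈ Ω') (n) : q ≠ (last, φ n) := fun h =>
    (Finset.mem_sdiff.1 hq).2 (Finset.mem_image.2 ⟨n, Finset.mem_univ _, h.symm⟩)
  rcases hi₀ with rfl | hi₀
  · exact gen_slice S i₀ φ hφ _ g hginj (fun j hj => (Finset.mem_sdiff.1 (hg j hj)).1)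
      (fun n => n.elim0) (fun _ _ n => n.elim0)
  · let T := Equiv.swap (g i₀) (last, ⟨t, hB⟩)
    have hT (q) (hq : q ∈ Ω') : T q ∈ Ω' := by
      simp only [T, Equiv.swap_apply_def]
      split_ifs
      exacts [hcorner, hg _ hi₀, hq]
    have hTi : T (g i₀) = (last, ⟨t, hB⟩) := Equiv.swap_apply_left _ _
    refine gen_slice S i₀ φ hφ _ (fun j => T (g j)) (T.injective.comp_injOn hginj)
      (fun j hj => (Finset.mem_sdiff.1 (hT _ (hg j hj))).1) (fun n => ?_) (fun j hj n => ?_)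
    · rw [hTi]
      exact hRsub (Finset.mem_image.2 ⟨n, Finset.mem_univ _, rfl⟩)
    · rw [hTi]
      exact hne _ (hT _ (hg j hj)) n

end Slices

section Blocks

/-- A combination of the matrices `x_j ⊗ y_j` and `x_{i₀} ⊗ e_{φ n}`, with the terms of index in
`S` left out. -/
def sliceSum {κ α β : Type*} [Fintype κ] [DecidableEq β] [DecidableEq κ] {r : ℕ} (S : Finset κ)
    (i₀ : κ) (φ : Fin r → β) (x : κ → α → ℂ) (y : κ → β → ℂ) (u : κ → ℂ) (w : Fin r → ℂ)
    (q : α × β) : ℂ :=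
  ∑ j, (if j ∈ S then 0 else u j * (x j q.1 * y j q.2)) +
    ∑ n, w n * (x i₀ q.1 * Pi.single (M := fun _ => ℂ) (φ n) 1 q.2)

section
variable {κ α β : Type*} [Fintype κ] [DecidableEq β] [DecidableEq κ] {r : ℕ} (S : Finset κ)
    (i₀ : κ) (φ : Fin r → β) (x : κ → α → ℂ) (y : κ → β → ℂ)

lemma sliceSum_add (u u' : κ → ℂ) (w w' : Fin r → ℂ) (q : α × β) :
    sliceSum S i₀ φ x y (u + u') (w + w') q =
      sliceSum S i₀ φ x y u w q + sliceSum S i₀ φ x y u' w' q := by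
  have (j : κ) : (if j ∈ S then 0 else (u + u') j * (x j q.1 * y j q.2)) =
      (if j ∈ S then 0 else u j * (x j q.1 * y j q.2)) +
      (if j ∈ S then 0 else u' j * (x j q.1 * y j q.2)) := by
    split_ifs <;> simp [add_mul]
  simp only [sliceSum, this, Finset.sum_add_distrib]
  simp only [Pi.add_apply, add_mul, Finset.sum_add_distrib]
  ring

lemma sliceSum_smul (c : ℂ) (u : κ → ℂ) (w : Fin r → ℂ) (q : α × β) :
    sliceSum S i₀ φ x y (c • u) (c • w) q = c * sliceSum S i₀ φ x y u w q := by
  simp only [sliceSum, mul_add, Finset.mul_sum, mul_ite, mul_zero, Pi.smul_apply, smul_eq_mul,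
    mul_assoc]

lemma sliceSum_zero (q : α × β) {u : κ → ℂ} (hu : ∀ j ∉ S, u j = 0) :
    sliceSum S i₀ φ x y u 0 q = 0 := by
  simp only [sliceSum, Pi.zero_apply, zero_mul, Finset.sum_const_zero, add_zero]
  refine Finset.sum_eq_zero fun j _ => ?_
  split_ifs with h
  · rfl
  · rw [hu j h, zero_mul]

lemma sliceSum_congr {x' : κ → α → ℂ} {y' : κ → β → ℂ} (hx : ∀ j ∉ S, x j = x' j)
    (hy : ∀ j ∉ S, y j = y' j) (h : r = 0 ∨ i₀ ∉ S) (u : κ → ℂ) (w : Fin r → ℂ) (q : α × β) :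
    sliceSum S i₀ φ x y u w q = sliceSum S i₀ φ x' y' u w q := by
  unfold sliceSum
  congr 1
  · refine Finset.sum_congr rfl fun j _ => ?_
    split_ifs with h
    · rfl
    · rw [hx j h, hy j h]
  · rcases h with rfl | h
    · simp
    · rw [hx _ h]

end

/-- Coefficients of the first slice in the system of equations left after eliminating the tangent
directions of the points of a block. -/
def redCoeff (t a b : ℕ) (ζ : ℕ ⊕ ℕ → ℂ) : ℂ :=
  if t ≤ b then (if t ≤ a then 1 else ζ (.inr a)) else (if t ≤ a then ζ (.inr b) else 0)

/-- Coefficients of the second slice in the system of equations left after eliminating the tangent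
directions of the points of a block. -/
def redCoeff' (t a b : ℕ) (ζ : ℕ ⊕ ℕ → ℂ) : ℂ :=
  if t ≤ b then (if t ≤ a then 0 else ζ (.inl a)) else (if t ≤ a then ζ (.inl b) else 0)

lemma gen_reduced {k A B r t : ℕ} (S : Finset (Fin k))
    (i₀ : Fin k) (φ : Fin r → Fin B) (x : Fin k → Fin A → ℂ) (y : Fin k → Fin B → ℂ)
    (h1 : ∀ u w, (∀ q ∈ blockSupp A B t 0 (t / 2), sliceSum S i₀ φ x y u w q = 0) →
      (∀ j ∉ S, u j = 0) ∧ w = 0)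
    (h2 : ∀ u w, (∀ q ∈ blockSupp A B t (t / 2) t, sliceSum S i₀ φ x y u w q = 0) →
      (∀ j ∉ S, u j = 0) ∧ w = 0) :
    Gen (fun ζ : ℕ ⊕ ℕ → ℂ => ∀ u u' w w',
      (∀ q : Fin A × Fin B, redCoeff t q.1 q.2 ζ * sliceSum S i₀ φ x y u w q =
        redCoeff' t q.1 q.2 ζ * sliceSum S i₀ φ x y u' w' q) →
      (∀ q : Fin A × Fin B, t ≤ q.1.1 → t ≤ q.2.1 → sliceSum S i₀ φ x y u' w' q = 0) →
      (∀ j ∉ S, u j = 0) ∧ (∀ j ∉ S, u' j = 0) ∧ w = 0 ∧ w' = 0) := by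
  let R := sliceSum S i₀ φ x y
  let Λ (ζ : ℕ ⊕ ℕ → ℂ) :
      ((Fin k → ℂ) × (Fin r → ℂ)) × ((Fin k → ℂ) × (Fin r → ℂ)) →ₗ[ℂ]
        ((Fin A × Fin B) ⊕ (Fin A × Fin B) ⊕ Fin k ⊕ Fin k → ℂ) :=
    { toFun := fun v => Sum.elim
        (fun q => redCoeff t q.1 q.2 ζ * R v.1.1 v.1.2 q - redCoeff' t q.1 q.2 ζ * R v.2.1 v.2.2 q)
        (Sum.elim (fun q => if t ≤ q.1.1 ∧ t ≤ q.2.1 then R v.2.1 v.2.2 q else 0)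
          (Sum.elim (fun j => if j ∈ S then v.1.1 j else 0)
            (fun j => if j ∈ S then v.2.1 j else 0)))
      map_add' := fun v v' => by
        ext (q | q | j | j)
        · simp only [R, Sum.elim_inl, Pi.add_apply, Prod.fst_add, Prod.snd_add, sliceSum_add]
          ring
        · simp only [R, Sum.elim_inl, Sum.elim_inr, Pi.add_apply, Prod.fst_add, Prod.snd_add,
            sliceSum_add]
          split_ifs <;> simp
        · simp only [Sum.elim_inl, Sum.elim_inr, Pi.add_apply, Prod.fst_add]
          split_ifs <;> simp
        · simp only [Sum.elim_inr, Pi.add_apply, Prod.fst_add, Prod.snd_add]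
          split_ifs <;> simp
      map_smul' := fun c v => by
        ext (q | q | j | j)
        · simp only [R, Sum.elim_inl, Pi.smul_apply, Prod.smul_fst, Prod.smul_snd, sliceSum_smul,
            smul_eq_mul, RingHom.id_apply]
          ring
        · simp only [R, Sum.elim_inl, Sum.elim_inr, Pi.smul_apply, Prod.smul_fst, Prod.smul_snd,
            sliceSum_smul, smul_eq_mul, RingHom.id_apply]
          split_ifs <;> simp
        · simp only [Sum.elim_inl, Sum.elim_inr, Pi.smul_apply, Prod.smul_fst, RingHom.id_apply]
          split_ifs <;> simp
        · simp only [Sum.elim_inr, Pi.smul_apply, Prod.smul_fst, Prod.smul_snd, RingHom.id_apply]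
          split_ifs <;> simp }
  have hΛ : Gen (fun ζ => ∀ v, Λ ζ v = 0 → v = 0) := by
    refine Gen.injective Λ (fun v q => ?_)
      (Sum.elim (fun i => if i < t / 2 then 0 else 1) (fun i => if i < t / 2 then 1 else 0)) ?_
    · rcases q with q | q | j | j
      · refine PolyFun.sub (PolyFun.mul ?_ (.const _)) (PolyFun.mul ?_ (.const _))
        · exact .ite (.ite (.const _) (.coord _)) (.ite (.coord _) (.const _))
        · exact .ite (.ite (.const _) (.coord _)) (.ite (.coord _) (.const _))
      all_goals exact PolyFun.const _
    · rintro ⟨⟨u, w⟩, ⟨u', w'⟩⟩ h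
      have e1 (q) := congrFun h (.inl q)
      have e2 (q) := congrFun h (.inr (.inl q))
      have e3 (j) := congrFun h (.inr (.inr (.inl j)))
      have e4 (j) := congrFun h (.inr (.inr (.inr j)))
      simp only [Λ, LinearMap.coe_mk, AddHom.coe_mk, Sum.elim_inl, Sum.elim_inr, Pi.zero_apply,
        redCoeff, redCoeff'] at e1 e2 e3 e4
      obtain ⟨hu, hw⟩ := h1 u w fun q hq => by
        simp only [blockSupp, Finset.mem_filter, Finset.mem_univ, true_and] at hq
        have h := e1 q
        rcases hq with ⟨ha, hb⟩ | ⟨-, ha, hb⟩ | ⟨ha, -, hb⟩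
        · simpa [ha, hb] using h
        · simpa [show ¬ t ≤ q.1.1 by omega, ha, hb] using h
        · simpa [show ¬ t ≤ q.2.1 by omega, ha, hb] using h
      obtain ⟨hu', hw'⟩ := h2 u' w' fun q hq => by
        simp only [blockSupp, Finset.mem_filter, Finset.mem_univ, true_and] at hq
        have h := e1 q
        rcases hq with ⟨ha, hb⟩ | ⟨ha', ha, hb⟩ | ⟨ha, hb', hb⟩
        · simpa [ha, hb] using e2 q
        · simpa [show ¬ t ≤ q.1.1 by omega, show ¬ q.1.1 < t / 2 by omega, hb] using h
        · simpa [show ¬ t ≤ q.2.1 by omega, show ¬ q.2.1 < t / 2 by omega, ha] using h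
      refine Prod.ext (Prod.ext (funext fun j => ?_) hw) (Prod.ext (funext fun j => ?_) hw')
      · by_cases hj : j ∈ S
        · simpa [hj] using e3 j
        · exact hu j hj
      · by_cases hj : j ∈ S
        · simpa [hj] using e4 j
        · exact hu' j hj
  refine hΛ.mono fun ζ hζ u u' w w' he hc => ?_
  let cut (u : Fin k → ℂ) (j : Fin k) : ℂ := if j ∈ S then 0 else u j
  have hcut (u w q) : R (cut u) w q = R u w q := by
    simp only [R, sliceSum, cut]
    congr 1
    refine Finset.sum_congr rfl fun j _ => ?_
    split_ifs <;> rfl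
  have := hζ ((cut u, w), (cut u', w')) (by
    ext (q | q | j | j)
    · simpa only [Λ, LinearMap.coe_mk, AddHom.coe_mk, Sum.elim_inl, hcut, Pi.zero_apply,
        sub_eq_zero] using he q
    · simp only [Λ, LinearMap.coe_mk, AddHom.coe_mk, Sum.elim_inl, Sum.elim_inr, hcut,
        Pi.zero_apply]
      split_ifs with h
      · exact hc q h.1 h.2
      · rfl
    · simp +contextual [Λ, cut]
    · simp +contextual [Λ, cut])
  obtain ⟨h12, h34⟩ := Prod.ext_iff.1 this
  obtain ⟨h1, h2⟩ := Prod.ext_iff.1 h12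
  obtain ⟨h3, h4⟩ := Prod.ext_iff.1 h34
  refine ⟨fun j hj => ?_, fun j hj => ?_, h2, h4⟩
  · simpa [cut, hj] using congrFun h1 j
  · simpa [cut, hj] using congrFun h3 j

end Blocks

section Blocks

/-- A combination of `x_j ⊗ y_j`, `x_{i₀} ⊗ e_{φ n}` and of tangent directions at the points of a
block. -/
def blockSum {k A B r t : ℕ} (σ : Fin t → Fin k) (i₀ : Fin k) (φ : Fin r → Fin B)
    (x : Fin k → Fin A → ℂ) (y : Fin k → Fin B → ℂ) (ζ : Fin t → ℂ)
    (u : Fin k → ℂ) (w : Fin r → ℂ) (η : Fin t → Fin B → ℂ) (ξ : Fin t → Fin A → ℂ)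
    (q : Fin A × Fin B) : ℂ :=
  sliceSum ∅ i₀ φ x y u w q + ∑ i, ζ i * (x (σ i) q.1 * η i q.2 + ξ i q.1 * y (σ i) q.2)

lemma blockSum_add {k A B r t : ℕ} (σ : Fin t → Fin k) (i₀ : Fin k) (φ : Fin r → Fin B)
    (x : Fin k → Fin A → ℂ) (y : Fin k → Fin B → ℂ) (ζ : Fin t → ℂ)
    (u u' : Fin k → ℂ) (w w' : Fin r → ℂ) (η η' : Fin t → Fin B → ℂ) (ξ ξ' : Fin t → Fin A → ℂ)
    (q : Fin A × Fin B) : blockSum σ i₀ φ x y ζ (u + u') (w + w') (η + η') (ξ + ξ') q =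
      blockSum σ i₀ φ x y ζ u w η ξ q + blockSum σ i₀ φ x y ζ u' w' η' ξ' q := by
  simp only [blockSum, sliceSum_add, Pi.add_apply, mul_add, add_mul, Finset.sum_add_distrib]
  ring

lemma blockSum_smul {k A B r t : ℕ} (σ : Fin t → Fin k) (i₀ : Fin k) (φ : Fin r → Fin B)
    (x : Fin k → Fin A → ℂ) (y : Fin k → Fin B → ℂ) (ζ : Fin t → ℂ) (c : ℂ)
    (u : Fin k → ℂ) (w : Fin r → ℂ) (η : Fin t → Fin B → ℂ) (ξ : Fin t → Fin A → ℂ)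
    (q : Fin A × Fin B) : blockSum σ i₀ φ x y ζ (c • u) (c • w) (c • η) (c • ξ) q =
      c * blockSum σ i₀ φ x y ζ u w η ξ q := by
  simp only [blockSum, sliceSum_smul, Pi.smul_apply, smul_eq_mul, mul_add, Finset.mul_sum]
  congr 1
  exact Finset.sum_congr rfl fun i _ => by ring

lemma exists_nondeg {t : ℕ} {P : (ℕ ⊕ ℕ → ℂ) → Prop} (hP : Gen P) :
    ∃ ζ, P ζ ∧ (∀ i : Fin t, ζ (.inl i) ≠ 0) ∧
      ∀ i j : Fin t, i ≠ j → ζ (.inl i) * ζ (.inr j) - ζ (.inr i) * ζ (.inl j) ≠ 0 := by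
  refine (hP.and ((Gen.forall fun i => ?_).and (Gen.forall fun i => Gen.forall fun j => ?_))).exists
  · exact (PolyFun.coord _).gen_ne_zero 1 (by simp)
  · by_cases h : i = j
    · exact .of_forall fun ζ h' => absurd h h'
    · refine ((((PolyFun.coord _).mul (.coord _)).sub ((PolyFun.coord _).mul
        (.coord _))).gen_ne_zero (Sum.elim (Pi.single i.1 1) (Pi.single j.1 1)) ?_).mono
        fun ζ hζ _ => hζ
      have : (i : ℕ) ≠ j := fun h' => h (Fin.ext h')
      simp [this]

lemma exists_block_injective {k A B c r t : ℕ} (σ : Fin t ↪ Fin k) {m₁ m₂ : Fin c} (hm : m₁ ≠ m₂)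
    (i₀ : Fin k) (φ : Fin r → Fin B) (hφ : Function.Injective φ) (hφt : ∀ n, t < (φ n).1)
    (hA : t < A) (hB : t < B) (hi₀ : r = 0 ∨ ∀ i, σ i ≠ i₀)
    (hcard : k + r ≤ (A - t) * (B - t) + t / 2 * (A - t + (B - t)) + t) :
    ∃ s : Par (Fin k) (Fin A) (Fin B) (Fin c) → ℂ, ∀ u u' w w' η ξ,
      (∀ i, ∑ b, η i b = 0) → (∀ i, ∑ a, ξ i a = 0) →
      (∀ q, blockSum σ i₀ φ (px s) (py s) (fun i => pz s (σ i) m₁) u w η ξ q = 0) →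
      (∀ q, blockSum σ i₀ φ (px s) (py s) (fun i => pz s (σ i) m₂) u' w' η ξ q = 0) →
      u = 0 ∧ u' = 0 ∧ w = 0 ∧ w' = 0 ∧ η = 0 ∧ ξ = 0 := by
  classical
  let S : Finset (Fin k) := Finset.univ.map σ
  have hS : S.card = t := by simp [S]
  have hmem (j) : j ∉ S ↔ ¬ ∃ i, σ i = j := by simp [S]
  have hi₀' : r = 0 ∨ i₀ ∉ S := hi₀.imp_right fun h => by simpa [S] using h
  have hhalf : t / 2 * (A - t + (B - t)) ≤ (t - t / 2) * (A - t + (B - t)) :=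
    Nat.mul_le_mul_right _ (by omega)
  obtain ⟨s, hs1, hs2⟩ := ((gen_blockSupp (γ := Fin c) (lo := 0) (hi := t / 2) S hS i₀ φ hφ hφt
    hA hB (by omega) hi₀' (by simpa using hcard)).and
    (gen_blockSupp (lo := t / 2) (hi := t) S hS i₀ φ hφ hφt hA hB le_rfl hi₀' (by omega))).exists
  let x : Fin k → Fin A → ℂ :=
    Function.extend σ (fun i => Pi.single (i.castLE hA.le) 1) (px s)
  let y : Fin k → Fin B → ℂ :=
    Function.extend σ (fun i => Pi.single (i.castLE hB.le) 1) (py s)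
  have hx (i) : x (σ i) = Pi.single (i.castLE hA.le) 1 := σ.injective.extend_apply _ _ _
  have hy (i) : y (σ i) = Pi.single (i.castLE hB.le) 1 := σ.injective.extend_apply _ _ _
  have hx' (j) (hj : j ∉ S) : px s j = x j := (Function.extend_apply' _ _ _ ((hmem j).1 hj)).symm
  have hy' (j) (hj : j ∉ S) : py s j = y j := (Function.extend_apply' _ _ _ ((hmem j).1 hj)).symm
  have hcongr := sliceSum_congr S i₀ φ (px s) (py s) hx' hy' hi₀'
  obtain ⟨ζ, hζ, hζ1, hζ2⟩ := exists_nondeg (t := t) (gen_reduced (t := t) S i₀ φ x y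
    (fun u w h => hs1 u w fun q hq => (hcongr u w q).trans (h q hq))
    (fun u w h => hs2 u w fun q hq => (hcongr u w q).trans (h q hq)))
  let z : Fin k → Fin c → ℂ :=
    Function.extend σ (fun i m => if m = m₁ then ζ (.inl i) else ζ (.inr i)) 0
  have hz1 (i) : z (σ i) m₁ = ζ (.inl i) := by
    simp [z, σ.injective.extend_apply]
  have hz2 (i) : z (σ i) m₂ = ζ (.inr i) := by
    simp [z, σ.injective.extend_apply, hm.symm]
  refine ⟨mkPar x y z, fun u u' w w' η ξ hη hξ h1 h2 => ?_⟩
  simp only [px_mkPar, py_mkPar, pz_mkPar, hz1, hz2] at h1 h2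
  let R := sliceSum S i₀ φ x y
  have hsum (v : Fin t → ℂ) (u w q) : blockSum σ i₀ φ x y v u w η ξ q = R u w q +
      ∑ i : Fin t, (if i.castLE hA.le = q.1 then (v i * η i q.2) else 0) +
      ∑ i : Fin t, (if i.castLE hB.le = q.2 then (v i * ξ i q.1) else 0) +
      ∑ i : Fin t, (if i.castLE hA.le = q.1 ∧ i.castLE hB.le = q.2 then u (σ i) else 0) := by
    have e1 : sliceSum ∅ i₀ φ x y u w q = R u w q + ∑ i, u (σ i) * (x (σ i) q.1 * y (σ i) q.2) := by
      have : ∑ i, u (σ i) * (x (σ i) q.1 * y (σ i) q.2) =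
          ∑ j, if j ∈ S then u j * (x j q.1 * y j q.2) else 0 := by
        rw [← Finset.sum_filter, show Finset.univ.filter (· ∈ S) = Finset.univ.map σ by
          ext; simp [S], Finset.sum_map]
      rw [this]
      simp only [R, sliceSum, Finset.notMem_empty, if_false]
      rw [add_right_comm, ← Finset.sum_add_distrib]
      congr 1
      exact Finset.sum_congr rfl fun j _ => by split_ifs <;> simp
    simp only [blockSum, e1, hx, hy, Pi.single_apply, mul_add, Finset.sum_add_distrib]
    have e2 : ∑ i : Fin t, u (σ i) * ((if q.1 = i.castLE hA.le then (1 : ℂ) else 0) *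
        (if q.2 = i.castLE hB.le then 1 else 0)) = ∑ i : Fin t,
        (if i.castLE hA.le = q.1 ∧ i.castLE hB.le = q.2 then u (σ i) else 0) :=
      Finset.sum_congr rfl fun i _ => by
        simp only [eq_comm (a := q.1), eq_comm (a := q.2), ite_and]
        split_ifs <;> simp
    have e3 : ∑ i : Fin t, v i * ((if q.1 = i.castLE hA.le then (1 : ℂ) else 0) * η i q.2) =
        ∑ i : Fin t, (if i.castLE hA.le = q.1 then (v i * η i q.2) else 0) :=
      Finset.sum_congr rfl fun i _ => by
        simp only [eq_comm (a := q.1)]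
        split_ifs <;> simp
    have e4 : ∑ i : Fin t, v i * (ξ i q.1 * (if q.2 = i.castLE hB.le then (1 : ℂ) else 0)) =
        ∑ i : Fin t, (if i.castLE hB.le = q.2 then (v i * ξ i q.1) else 0) :=
      Finset.sum_congr rfl fun i _ => by
        simp only [eq_comm (a := q.2)]
        split_ifs <;> simp
    rw [e2, e3, e4]
    ring
  have hle {n : ℕ} (hn : t < n) (i : Fin t) (a : Fin n) (ha : t ≤ a.1) : i.castLE hn.le ≠ a :=
    fun h => by have := congrArg Fin.val h; simp at this; omega
  have F1 (v u w a b) (ha : t ≤ a.1) (hb : t ≤ b.1) :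
      blockSum σ i₀ φ x y v u w η ξ (a, b) = R u w (a, b) := by
    simp [hsum, hle hA _ a ha, hle hB _ b hb]
  have F2 (v u w i b) (hb : t ≤ b.1) :
      blockSum σ i₀ φ x y v u w η ξ (i.castLE hA.le, b) =
        R u w (i.castLE hA.le, b) + v i * η i b := by
    simp [hsum, hle hB _ b hb]
  have F3 (v u w a i) (ha : t ≤ a.1) :
      blockSum σ i₀ φ x y v u w η ξ (a, i.castLE hB.le) =
        R u w (a, i.castLE hB.le) + v i * ξ i a := by
    simp [hsum, hle hA _ a ha]
  have F4 (v u w i j) :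
      blockSum σ i₀ φ x y v u w η ξ (i.castLE hA.le, j.castLE hB.le) =
        R u w (i.castLE hA.le, j.castLE hB.le) + v i * η i (j.castLE hB.le) +
        v j * ξ j (i.castLE hA.le) + if i = j then u (σ i) else 0 := by
    simp [hsum, ite_and, eq_comm]
  obtain ⟨hu, hu', rfl, rfl⟩ := hζ u u' w w' (fun q => by
      obtain ⟨a, b⟩ := q
      simp only [redCoeff, redCoeff']
      split_ifs with hb ha ha
      · have := h1 (a, b)
        rw [F1 _ _ _ _ _ ha hb] at this
        simp only [R] at this
        simp [this]
      · have e1 := h1 (a, b)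
        have e2 := h2 (a, b)
        obtain ⟨i, rfl⟩ : ∃ i : Fin t, i.castLE hA.le = a := ⟨⟨a, by omega⟩, rfl⟩
        rw [F2 _ _ _ _ _ hb] at e1 e2
        simp only [R] at e1 e2
        simp only [Fin.val_castLE]
        linear_combination ζ (.inr i) * e1 - ζ (.inl i) * e2
      · have e1 := h1 (a, b)
        have e2 := h2 (a, b)
        obtain ⟨i, rfl⟩ : ∃ i : Fin t, i.castLE hB.le = b := ⟨⟨b, by omega⟩, rfl⟩
        rw [F3 _ _ _ _ _ ha] at e1 e2
        simp only [R] at e1 e2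
        simp only [Fin.val_castLE]
        linear_combination ζ (.inr i) * e1 - ζ (.inl i) * e2
      · simp) (fun q ha hb => by
      rw [← h2 q]
      exact (F1 _ _ _ _ _ ha hb).symm)
  have hR (q) : R u 0 q = 0 := sliceSum_zero S i₀ φ x y q hu
  have hR' (q) : R u' 0 q = 0 := sliceSum_zero S i₀ φ x y q hu'
  have hoff (i j : Fin t) (hij : i ≠ j) :
      η i (j.castLE hB.le) = 0 ∧ ξ j (i.castLE hA.le) = 0 := by
    have e1 := h1 (i.castLE hA.le, j.castLE hB.le)
    have e2 := h2 (i.castLE hA.le, j.castLE hB.le)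
    rw [F4, if_neg hij, hR] at e1
    rw [F4, if_neg hij, hR'] at e2
    have hd := hζ2 i j hij
    constructor
    · refine (mul_eq_zero.1 ?_).resolve_left hd
      linear_combination ζ (.inr j) * e1 - ζ (.inl j) * e2
    · refine (mul_eq_zero.1 ?_).resolve_left hd
      linear_combination ζ (.inl i) * e2 - ζ (.inr i) * e1
  have hη0 (i) (b : Fin B) (hb : b ≠ i.castLE hB.le) : η i b = 0 := by
    by_cases hbt : t ≤ b.1
    · have e1 := h1 (i.castLE hA.le, b)
      rw [F2 _ _ _ _ _ hbt, hR, zero_add] at e1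
      exact (mul_eq_zero.1 e1).resolve_left (hζ1 i)
    · obtain ⟨j, rfl⟩ : ∃ j : Fin t, j.castLE hB.le = b := ⟨⟨b, by omega⟩, rfl⟩
      exact (hoff i j fun h => hb (h ▸ rfl)).1
  have hξ0 (i) (a : Fin A) (ha : a ≠ i.castLE hA.le) : ξ i a = 0 := by
    by_cases hat : t ≤ a.1
    · have e1 := h1 (a, i.castLE hB.le)
      rw [F3 _ _ _ _ _ hat, hR, zero_add] at e1
      exact (mul_eq_zero.1 e1).resolve_left (hζ1 i)
    · obtain ⟨j, rfl⟩ : ∃ j : Fin t, j.castLE hA.le = a := ⟨⟨a, by omega⟩, rfl⟩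
      exact (hoff j i fun h => ha (h ▸ rfl)).2
  have hηz : η = 0 := by
    ext i b
    by_cases hb : b = i.castLE hB.le
    · rw [hb, Pi.zero_apply, Pi.zero_apply, ← hη i]
      exact (Finset.sum_eq_single _ (fun b' _ hb' => hη0 i b' hb') (by simp)).symm
    · exact hη0 i b hb
  have hξz : ξ = 0 := by
    ext i a
    by_cases ha : a = i.castLE hA.le
    · rw [ha, Pi.zero_apply, Pi.zero_apply, ← hξ i]
      exact (Finset.sum_eq_single _ (fun b' _ hb' => hξ0 i b' hb') (by simp)).symm
    · exact hξ0 i a ha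
  refine ⟨?_, ?_, rfl, rfl, hηz, hξz⟩
  · ext j
    by_cases hj : j ∈ S
    · obtain ⟨i, -, rfl⟩ := Finset.mem_map.1 hj
      have e := h1 (i.castLE hA.le, i.castLE hB.le)
      rw [F4, hR] at e
      simpa [hηz, hξz] using e
    · exact hu j hj
  · ext j
    by_cases hj : j ∈ S
    · obtain ⟨i, -, rfl⟩ := Finset.mem_map.1 hj
      have e := h2 (i.castLE hA.le, i.castLE hB.le)
      rw [F4, hR'] at e
      simpa [hηz, hξz] using e
    · exact hu' j hj

/-- For generic points, two slices determine the tangent coordinates at the points of a block. -/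
lemma gen_block {k A B c r t : ℕ} (σ : Fin t ↪ Fin k) {m₁ m₂ : Fin c} (hm : m₁ ≠ m₂)
    (i₀ : Fin k) (φ : Fin r → Fin B) (hφ : Function.Injective φ) (hφt : ∀ n, t < (φ n).1)
    (hA : t < A) (hB : t < B) (hi₀ : r = 0 ∨ ∀ i, σ i ≠ i₀)
    (hcard : k + r ≤ (A - t) * (B - t) + t / 2 * (A - t + (B - t)) + t) :
    Gen (fun s : Par (Fin k) (Fin A) (Fin B) (Fin c) → ℂ => ∀ u u' w w' η ξ,
      (∀ i, ∑ b, η i b = 0) → (∀ i, ∑ a, ξ i a = 0) →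
      (∀ q, blockSum σ i₀ φ (px s) (py s) (fun i => pz s (σ i) m₁) u w η ξ q = 0) →
      (∀ q, blockSum σ i₀ φ (px s) (py s) (fun i => pz s (σ i) m₂) u' w' η ξ q = 0) →
      u = 0 ∧ u' = 0 ∧ w = 0 ∧ w' = 0 ∧ η = 0 ∧ ξ = 0) := by
  obtain ⟨s₀, hs₀⟩ := exists_block_injective σ hm i₀ φ hφ hφt hA hB hi₀ hcard
  let Λ (s : Par (Fin k) (Fin A) (Fin B) (Fin c) → ℂ) :
      ((Fin k → ℂ) × (Fin k → ℂ)) × ((Fin r → ℂ) × (Fin r → ℂ)) ×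
        ((Fin t → Fin B → ℂ) × (Fin t → Fin A → ℂ)) →ₗ[ℂ]
      ((Fin A × Fin B) ⊕ (Fin A × Fin B) ⊕ Fin t ⊕ Fin t → ℂ) :=
    { toFun := fun v => Sum.elim
        (blockSum σ i₀ φ (px s) (py s) (fun i => pz s (σ i) m₁) v.1.1 v.2.1.1 v.2.2.1 v.2.2.2)
        (Sum.elim
          (blockSum σ i₀ φ (px s) (py s) (fun i => pz s (σ i) m₂) v.1.2 v.2.1.2 v.2.2.1 v.2.2.2)
          (Sum.elim (fun i => ∑ b, v.2.2.1 i b) (fun i => ∑ a, v.2.2.2 i a)))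
      map_add' := fun v v' => by
        ext (q | q | j | j)
        · exact blockSum_add ..
        · exact blockSum_add ..
        · simp [Finset.sum_add_distrib]
        · simp [Finset.sum_add_distrib]
      map_smul' := fun c v => by
        ext (q | q | j | j)
        · exact blockSum_smul ..
        · exact blockSum_smul ..
        · simp [Finset.mul_sum]
        · simp [Finset.mul_sum] }
  have hpoly (m : Fin c) (u w η ξ q) : PolyFun (fun s : Par (Fin k) (Fin A) (Fin B) (Fin c) → ℂ =>
      blockSum σ i₀ φ (px s) (py s) (fun i => pz s (σ i) m) u w η ξ q) := by
    refine PolyFun.add (PolyFun.add (PolyFun.sum _ fun j _ => ?_) (PolyFun.sum _ fun n _ => ?_))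
      (PolyFun.sum _ fun i _ => ?_)
    · exact .ite (.const _) ((PolyFun.const _).mul ((PolyFun.px _ _).mul (PolyFun.py _ _)))
    · exact (PolyFun.const _).mul ((PolyFun.px _ _).mul (PolyFun.const _))
    · exact (PolyFun.pz _ _).mul (((PolyFun.px _ _).mul (.const _)).add
        ((PolyFun.const _).mul (.py _ _)))
  have hΛ : Gen (fun s => ∀ v, Λ s v = 0 → v = 0) := by
    refine Gen.injective Λ (fun v q => ?_) s₀ ?_
    · rcases q with q | q | j | j
      · exact hpoly _ _ _ _ _ _
      · exact hpoly _ _ _ _ _ _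
      · exact PolyFun.const _
      · exact PolyFun.const _
    · rintro ⟨⟨u, u'⟩, ⟨w, w'⟩, ⟨η, ξ⟩⟩ h
      obtain ⟨rfl, rfl, rfl, rfl, rfl, rfl⟩ := hs₀ u u' w w' η ξ
        (fun i => congrFun h (.inr (.inr (.inl i)))) (fun i => congrFun h (.inr (.inr (.inr i))))
        (fun q => congrFun h (.inl q)) (fun q => congrFun h (.inr (.inl q)))
      rfl
  refine hΛ.mono fun s hs u u' w w' η ξ hη hξ h1 h2 => ?_
  have := hs ((u, u'), (w, w'), (η, ξ)) (by
    ext (q | q | j | j)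
    exacts [h1 q, h2 q, hη j, hξ j])
  simpa [and_assoc] using this

end Blocks

section AllSlices

/-- A general element of the sum of the tangent spaces at the points `x_i ⊗ y_i ⊗ z_i`. -/
def tanSum {κ α β γ : Type*} [Fintype κ] (x : κ → α → ℂ) (y : κ → β → ℂ) (z : κ → γ → ℂ)
    (u : κ → γ → ℂ) (η : κ → β → ℂ) (ξ : κ → α → ℂ) (a : α) (b : β) (m : γ) : ℂ :=
  ∑ i, (u i m * (x i a * y i b) + z i m * (x i a * η i b + ξ i a * y i b))

/-- Restrict the third vector of each point to the pair of slices assigned to it. -/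
def cutZ {k c P : ℕ} (l : Fin k → Option (Fin P)) (z : Fin k → Fin c → ℂ) (i : Fin k)
    (m : Fin c) : ℂ :=
  if (l i).map Fin.val = some (m.1 / 2) then z i m else 0

/-- The points assigned to a given pair of slices. -/
def fiber {k P : ℕ} (l : Fin k → Option (Fin P)) (p : Fin P) : Finset (Fin k) :=
  Finset.univ.filter (l · = some p)

lemma sum_fiber {k P : ℕ} (l : Fin k → Option (Fin P)) (p : Fin P) (f : Fin k → ℂ) :
    ∑ i, f ((fiber l p).orderEmbOfFin rfl i) = ∑ i, if l i = some p then f i else 0 := by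
  rw [← Finset.sum_filter, ← Finset.sum_coe_sort (Finset.univ.filter _)]
  exact Fintype.sum_equiv ((fiber l p).orderIsoOfFin rfl).toEquiv _ (fun i => f i.1) fun i => rfl

lemma gen_slices {k A B c r P t₀ : ℕ} (hP : 2 * P ≤ c) (l : Fin k → Option (Fin P))
    (hl : ∀ p, (fiber l p).card ≤ t₀)
    (i₀ : Fin k) (φ : Fin r → Fin B) (hφ : Function.Injective φ) (hφt : ∀ n, t₀ < (φ n).1)
    (hA : t₀ < A) (hB : t₀ < B) (hi₀ : r = 0 ∨ l i₀ = none)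
    (hcard : ∀ t ≤ t₀, k + r ≤ (A - t) * (B - t) + t / 2 * (A - t + (B - t)) + t) :
    Gen (fun s : Par (Fin k) (Fin A) (Fin B) (Fin c) → ℂ => ∀ u (w : Fin r → Fin c → ℂ) η ξ,
      (∀ i, ∑ b, η i b = 0) → (∀ i, ∑ a, ξ i a = 0) →
      (∀ a b m, tanSum (px s) (py s) (cutZ l (pz s)) u η ξ a b m +
        ∑ n, w n m * (px s i₀ a * Pi.single (M := fun _ => ℂ) (φ n) 1 b) = 0) →
      u = 0 ∧ w = 0 ∧ ∀ i, l i ≠ none → η i = 0 ∧ ξ i = 0) := by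
  have hblock (p : Fin P) := gen_block (m₁ := (⟨2 * p.1, by omega⟩ : Fin c))
    (m₂ := ⟨2 * p.1 + 1, by omega⟩) ((fiber l p).orderEmbOfFin rfl).toEmbedding (by simp) i₀ φ hφ
    (fun n => (hl p).trans_lt (hφt n)) ((hl p).trans_lt hA) ((hl p).trans_lt hB)
    (hi₀.imp_right fun h i hi => by
      have := Finset.orderEmbOfFin_mem (fiber l p) rfl i
      rw [show ((fiber l p).orderEmbOfFin rfl) i = i₀ from hi] at this
      simp [fiber, h] at this)
    (hcard _ (hl p))
  have hrest := gen_blockSupp (γ := Fin c) (t := 0) (lo := 0) (hi := 0) (∅ : Finset (Fin k)) rfl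
    i₀ φ hφ (fun n => (Nat.zero_le _).trans_lt (hφt n)) ((Nat.zero_le _).trans_lt hA)
    ((Nat.zero_le _).trans_lt hB) le_rfl (.inr (by simp)) (by simpa using hcard 0 (Nat.zero_le _))
  refine ((Gen.forall hblock).and hrest).mono fun s ⟨hs, hs'⟩ u w η ξ hη hξ h => ?_
  have hdec (m : Fin c) (q : Fin A × Fin B) :
      tanSum (px s) (py s) (cutZ l (pz s)) u η ξ q.1 q.2 m +
        ∑ n, w n m * (px s i₀ q.1 * Pi.single (M := fun _ => ℂ) (φ n) 1 q.2) =
      sliceSum ∅ i₀ φ (px s) (py s) (fun i => u i m) (fun n => w n m) q +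
        ∑ i, cutZ l (pz s) i m * (px s i q.1 * η i q.2 + ξ i q.1 * py s i q.2) := by
    simp only [tanSum, sliceSum, Finset.notMem_empty, if_false, Finset.sum_add_distrib]
    ring
  have hpair (p : Fin P) (m : Fin c) (hm : m.1 / 2 = p.1) (q : Fin A × Fin B) :
      blockSum ((fiber l p).orderEmbOfFin rfl).toEmbedding i₀ φ (px s) (py s)
        (fun i => pz s ((fiber l p).orderEmbOfFin rfl i) m) (fun i => u i m) (fun n => w n m)
        (fun i => η ((fiber l p).orderEmbOfFin rfl i))
        (fun i => ξ ((fiber l p).orderEmbOfFin rfl i)) q = 0 := by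
    rw [← h q.1 q.2 m, hdec]
    unfold blockSum
    congr 1
    refine (sum_fiber l p (fun i =>
      pz s i m * (px s i q.1 * η i q.2 + ξ i q.1 * py s i q.2))).trans ?_
    refine Finset.sum_congr rfl fun i _ => ?_
    have : (l i).map Fin.val = some (m.1 / 2) ↔ l i = some p := by
      rw [hm]
      cases l i <;> simp [Fin.ext_iff]
    simp only [cutZ, this]
    split_ifs <;> simp
  have hp (p : Fin P) := hs p _ _ _ _ _ _ (fun i => hη _) (fun i => hξ _)
    (hpair p ⟨2 * p.1, by omega⟩ (by simp))
    (hpair p ⟨2 * p.1 + 1, by omega⟩ (by simp only; omega))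
  have hm (m : Fin c) : (fun i => u i m) = 0 ∧ (fun n => w n m) = 0 := by
    by_cases hm : m.1 / 2 < P
    · obtain ⟨h1, h2, h3, h4, -⟩ := hp ⟨m.1 / 2, hm⟩
      rcases Nat.mod_two_eq_zero_or_one m.1 with hm' | hm'
      · have e : (⟨2 * (m.1 / 2), by omega⟩ : Fin c) = m := Fin.ext (by simp only; omega)
        exact ⟨by simpa only [e] using h1, by simpa only [e] using h3⟩
      · have e : (⟨2 * (m.1 / 2) + 1, by omega⟩ : Fin c) = m := Fin.ext (by simp only; omega)
        exact ⟨by simpa only [e] using h2, by simpa only [e] using h4⟩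
    · have := hs' (fun i => u i m) (fun n => w n m) fun q _ => by
        have e := h q.1 q.2 m
        rw [hdec] at e
        refine Eq.trans (Eq.symm ?_) e
        refine (add_eq_left).2 (Finset.sum_eq_zero fun i _ => ?_)
        have : ¬ (l i).map Fin.val = some (m.1 / 2) := by
          cases l i with
          | none => simp
          | some v =>
            simp only [Option.map_some, Option.some.injEq]
            omega
        simp [cutZ, this]
      exact ⟨funext fun i => this.1 i (by simp), this.2⟩
  refine ⟨?_, ?_, fun i hi => ?_⟩
  · ext i m
    exact congrFun (hm m).1 i
  · ext n m
    exact congrFun (hm m).2 n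
  · obtain ⟨p, hlp⟩ := Option.ne_none_iff_exists'.1 hi
    obtain ⟨-, -, -, -, h5, h6⟩ := hp p
    have hi' : i ∈ fiber l p := by simp [fiber, hlp]
    obtain ⟨j, hj⟩ : ∃ j, (fiber l p).orderEmbOfFin rfl j = i := by
      have : i ∈ Set.range ((fiber l p).orderEmbOfFin rfl) := by simpa using hi'
      exact this
    exact ⟨by simpa [hj] using congrFun h5 j, by simpa [hj] using congrFun h6 j⟩

end AllSlices

section TangentMap

/-- Vectors with coordinate sum zero. -/
def zeroSum (β : Type*) [Fintype β] : Submodule ℂ (β → ℂ) :=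
  LinearMap.ker (∑ b, LinearMap.proj b : (β → ℂ) →ₗ[ℂ] ℂ)

lemma mem_zeroSum {β : Type*} [Fintype β] {v : β → ℂ} : v ∈ zeroSum β ↔ ∑ b, v b = 0 := by
  simp [zeroSum]

lemma finrank_zeroSum (β : Type*) [Fintype β] [Nonempty β] :
    Module.finrank ℂ (zeroSum β) + 1 = Fintype.card β := by
  classical
  have hsurj : Function.Surjective (∑ b, LinearMap.proj b : (β → ℂ) →ₗ[ℂ] ℂ) := fun v =>
    ⟨Pi.single (Classical.arbitrary β) v, by simp⟩
  have := LinearMap.finrank_range_add_finrank_ker (∑ b, LinearMap.proj b : (β → ℂ) →ₗ[ℂ] ℂ)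
  rw [LinearMap.range_eq_top.2 hsurj] at this
  simp only [finrank_top, Module.finrank_self, Module.finrank_fintype_fun_eq_card] at this
  rw [← this, add_comm]
  rfl

variable {κ α β γ : Type*} [Fintype κ] [Fintype α] [Fintype β]

/-- Independent coordinates on the tangent spaces at a family of points. -/
abbrev TanCoord (κ α β γ : Type*) [Fintype α] [Fintype β] :=
  κ → (γ → ℂ) × zeroSum β × zeroSum α

/-- The parametrization of the sum of the tangent spaces at the points `x_i ⊗ y_i ⊗ z_i`. -/
def tanMap (x : κ → α → ℂ) (y : κ → β → ℂ) (z : κ → γ → ℂ) :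
    TanCoord κ α β γ →ₗ[ℂ] (α × β × γ → ℂ) where
  toFun τ q := tanSum x y z (fun i => (τ i).1) (fun i => (τ i).2.1) (fun i => (τ i).2.2)
    q.1 q.2.1 q.2.2
  map_add' τ τ' := by
    ext q
    simp only [tanSum, Pi.add_apply, Prod.fst_add, Prod.snd_add, Submodule.coe_add,
      ← Finset.sum_add_distrib]
    exact Finset.sum_congr rfl fun i _ => by ring
  map_smul' v τ := by
    ext q
    simp only [tanSum, Pi.smul_apply, Prod.smul_fst, Prod.smul_snd, Submodule.coe_smul,
      smul_eq_mul, Finset.mul_sum, RingHom.id_apply]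
    exact Finset.sum_congr rfl fun i _ => by ring

lemma tanMap_apply (x : κ → α → ℂ) (y : κ → β → ℂ) (z : κ → γ → ℂ) (τ : TanCoord κ α β γ)
    (q : α × β × γ) : tanMap x y z τ q = tanSum x y z (fun i => (τ i).1) (fun i => (τ i).2.1)
      (fun i => (τ i).2.2) q.1 q.2.1 q.2.2 := rfl

lemma polyFun_tanMap (τ : TanCoord κ α β γ) (q : α × β × γ) :
    PolyFun (fun s : Par κ α β γ → ℂ => tanMap (px s) (py s) (pz s) τ q) :=
  PolyFun.sum _ fun _ _ => ((PolyFun.const _).mul ((PolyFun.px _ _).mul (.py _ _))).add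
    ((PolyFun.pz _ _).mul (((PolyFun.px _ _).mul (.const _)).add
      ((PolyFun.const _).mul (.py _ _))))

lemma card_fiber_le {k P t₀ : ℕ} (l : Fin k → Option (Fin P))
    (hl : ∀ i p, l i = some p → i.1 / t₀ = p.1) (ht : 0 < t₀) (p : Fin P) :
    (fiber l p).card ≤ t₀ := by
  calc (fiber l p).card ≤ (Finset.Ico (p.1 * t₀) (p.1 * t₀ + t₀)).card := by
        refine Finset.card_le_card_of_injOn Fin.val (fun i hi => ?_) Fin.val_injective.injOn
        have hi' : l i = some p := by simpa [fiber] using hi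
        have h1 := hl i p hi'
        have h2 := Nat.div_add_mod i.1 t₀
        have h3 := Nat.mod_lt i.1 ht
        rw [h1, mul_comm] at h2
        simp only [Finset.coe_Ico, Set.mem_Ico]
        omega
    _ = t₀ := by simp

variable {k a b c r P t₀ : ℕ}

lemma TanCoord.eq_zero {τ : TanCoord (Fin k) (Fin a) (Fin b) (Fin c)}
    (h1 : (fun i => (τ i).1) = 0) (h2 : ∀ i, ((τ i).2.1 : Fin b → ℂ) = 0 ∧
      ((τ i).2.2 : Fin a → ℂ) = 0) : τ = 0 :=
  funext fun i => Prod.ext (congrFun h1 i)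
    (Prod.ext (Subtype.ext (h2 i).1) (Subtype.ext (h2 i).2))

/-- Tangent spaces at generic points are independent. -/
lemma gen_tanMap_injective (hk : 0 < k) (hP : 2 * P ≤ c) (hkP : k ≤ P * t₀) (hA : t₀ < a)
    (hB : t₀ < b)
    (hcard : ∀ t ≤ t₀, k ≤ (a - t) * (b - t) + t / 2 * (a - t + (b - t)) + t) :
    Gen (fun s : Par (Fin k) (Fin a) (Fin b) (Fin c) → ℂ =>
      ∀ τ, tanMap (px s) (py s) (pz s) τ = 0 → τ = 0) := by
  have ht₀ : 0 < t₀ := Nat.pos_of_ne_zero fun h => by subst h; omega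
  let l (i : Fin k) : Option (Fin P) :=
    some ⟨i.1 / t₀, Nat.div_lt_of_lt_mul (by rw [mul_comm]; omega)⟩
  obtain ⟨s, hs⟩ := (gen_slices (A := a) (B := b) (r := 0) hP l
    (card_fiber_le l (fun i p h => by simpa [l, Fin.ext_iff] using h) ht₀) ⟨0, hk⟩ Fin.elim0
    (fun n => n.elim0) (fun n => n.elim0) hA hB (.inl rfl) hcard).exists
  refine Gen.injective _ (fun τ q => polyFun_tanMap τ q)
    (mkPar (px s) (py s) (cutZ l (pz s))) fun τ hτ => ?_
  obtain ⟨h1, -, h2⟩ := hs (fun i => (τ i).1) 0 (fun i => (τ i).2.1) (fun i => (τ i).2.2)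
    (fun i => mem_zeroSum.1 (τ i).2.1.2) (fun i => mem_zeroSum.1 (τ i).2.2.2)
    (fun a b m => by simpa [tanMap_apply] using congrFun hτ (a, b, m))
  exact TanCoord.eq_zero h1 fun i => h2 i (by simp [l])

lemma gen_last_slice (i₀ : Fin k) (hcard : k ≤ a * b + 1) :
    Gen (fun s : Par (Fin k) (Fin (a + 1)) (Fin (b + 1)) γ → ℂ => ∀ (u : Fin k → ℂ)
      (η : zeroSum (Fin (b + 1))) (ξ : zeroSum (Fin (a + 1))),
      (∀ i j, ∑ n, u n * (px s n i * py s n j) + (px s i₀ i * η.1 j + ξ.1 i * py s i₀ j) = 0) →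
      u = 0 ∧ η = 0 ∧ ξ = 0) := by
  classical
  let Λ (s : Par (Fin k) (Fin (a + 1)) (Fin (b + 1)) γ → ℂ) :
      (Fin k → ℂ) × zeroSum (Fin (b + 1)) × zeroSum (Fin (a + 1)) →ₗ[ℂ]
        (Fin (a + 1) × Fin (b + 1) → ℂ) :=
    { toFun := fun v q => ∑ n, v.1 n * (px s n q.1 * py s n q.2) +
        (px s i₀ q.1 * v.2.1.1 q.2 + v.2.2.1 q.1 * py s i₀ q.2)
      map_add' := fun v v' => by
        ext q
        simp only [Prod.fst_add, Prod.snd_add, Pi.add_apply, Submodule.coe_add, add_mul,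
          Finset.sum_add_distrib]
        ring
      map_smul' := fun v v' => by
        ext q
        simp only [Prod.smul_fst, Prod.smul_snd, Pi.smul_apply, Submodule.coe_smul, smul_eq_mul,
          RingHom.id_apply, mul_add, Finset.mul_sum, mul_assoc]
        ring }
  obtain ⟨e⟩ : Nonempty ({j // j ≠ i₀} ↪ Fin a × Fin b) :=
    Function.Embedding.nonempty_of_card_le (by
      rw [Fintype.card_subtype_compl, Fintype.card_subtype_eq]
      simp
      omega)
  let pos (j : Fin k) : Fin (a + 1) × Fin (b + 1) :=
    if h : j = i₀ then (0, 0) else ((e ⟨j, h⟩).1.succ, (e ⟨j, h⟩).2.succ)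
  have hpos0 : pos i₀ = (0, 0) := by simp [pos]
  have hpos (j) (h : j ≠ i₀) : pos j = ((e ⟨j, h⟩).1.succ, (e ⟨j, h⟩).2.succ) := by
    simp [pos, h]
  have hinj : Function.Injective pos := by
    intro j j' h
    by_cases hj : j = i₀ <;> by_cases hj' : j' = i₀
    · rw [hj, hj']
    · rw [hj, hpos0, hpos j' hj'] at h
      exact absurd (Prod.ext_iff.1 h).1 (Fin.succ_ne_zero _).symm
    · rw [hj', hpos0, hpos j hj] at h
      exact absurd (Prod.ext_iff.1 h).1 (Fin.succ_ne_zero _)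
    · rw [hpos j hj, hpos j' hj', Prod.ext_iff] at h
      have := e.injective (Prod.ext (Fin.succ_injective _ h.1) (Fin.succ_injective _ h.2))
      simpa using this
  have hΛ : Gen (fun s => ∀ v, Λ s v = 0 → v = 0) := by
    refine Gen.injective Λ (fun v q => ?_)
      (mkPar (fun j => Pi.single (pos j).1 1) (fun j => Pi.single (pos j).2 1) 0) ?_
    · exact (PolyFun.sum _ fun j _ => (PolyFun.const _).mul ((PolyFun.px _ _).mul
        (PolyFun.py _ _))).add (((PolyFun.px _ _).mul (.const _)).add
          ((PolyFun.const _).mul (.py _ _)))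
    · rintro ⟨u, η, ξ⟩ h
      have key (i j) : ∑ n, (if pos n = (i, j) then u n else 0) +
          ((if i = 0 then η.1 j else 0) + (if j = 0 then ξ.1 i else 0)) = 0 := by
        have := congrFun h (i, j)
        simp only [Λ, LinearMap.coe_mk, AddHom.coe_mk, px_mkPar, py_mkPar, Pi.zero_apply,
          mul_single_mul_single, hpos0] at this
        refine Eq.trans ?_ this
        simp [Pi.single_apply]
      have hη' (j) (hj : j ≠ 0) : η.1 j = 0 := by
        have := key 0 j
        rw [Finset.sum_eq_zero] at this
        · simpa [hj] using this
        · intro n _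
          rw [if_neg]
          intro hn
          by_cases h : n = i₀
          · rw [h, hpos0, Prod.ext_iff] at hn
            exact hj hn.2.symm
          · rw [hpos n h, Prod.ext_iff] at hn
            exact Fin.succ_ne_zero _ hn.1
      have hξ' (i) (hi : i ≠ 0) : ξ.1 i = 0 := by
        have := key i 0
        rw [Finset.sum_eq_zero] at this
        · simpa [hi] using this
        · intro n _
          rw [if_neg]
          intro hn
          by_cases h : n = i₀
          · rw [h, hpos0, Prod.ext_iff] at hn
            exact hi hn.1.symm
          · rw [hpos n h, Prod.ext_iff] at hn
            exact Fin.succ_ne_zero _ hn.2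
      have hη : η.1 = 0 := by
        ext j
        by_cases hj : j = 0
        · rw [hj, Pi.zero_apply, ← mem_zeroSum.1 η.2]
          exact (Finset.sum_eq_single _ (fun j' _ h => hη' j' h) (by simp)).symm
        · exact hη' j hj
      have hξ : ξ.1 = 0 := by
        ext j
        by_cases hj : j = 0
        · rw [hj, Pi.zero_apply, ← mem_zeroSum.1 ξ.2]
          exact (Finset.sum_eq_single _ (fun j' _ h => hξ' j' h) (by simp)).symm
        · exact hξ' j hj
      refine Prod.ext (funext fun n => ?_) (Prod.ext (Subtype.ext hη) (Subtype.ext hξ))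
      have := key (pos n).1 (pos n).2
      rw [Finset.sum_eq_single n (fun n' _ h => if_neg fun h' => h (hinj h')) (by simp)] at this
      simpa [hη, hξ] using this
  refine hΛ.mono fun s hs u η ξ h => ?_
  have := hs (u, η, ξ) (funext fun q => h q.1 q.2)
  simpa using this

/-- There are points, with `z_{i₀}` the last basis vector, for which the tangent spaces and the
spaces `x_{i₀} ⊗ e_{φ n} ⊗ ⟨e_0, …, e_{c-1}⟩` are independent. -/
lemma exists_tanMap_add_injective (i₀ : Fin k) (hP : 2 * P ≤ c) (hkP : k ≤ P * t₀)
    (hA : t₀ < a + 1) (hB : t₀ < b + 1) (hab : k ≤ a * b + 1)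
    (φ : Fin r → Fin (b + 1)) (hφ : Function.Injective φ) (hφt : ∀ n, t₀ < (φ n).1)
    (hcard : ∀ t ≤ t₀, k + r ≤ (a + 1 - t) * (b + 1 - t) + t / 2 * (a + 1 - t + (b + 1 - t)) + t) :
    ∃ s : Par (Fin k) (Fin (a + 1)) (Fin (b + 1)) (Fin (c + 1)) → ℂ,
      ∀ τ (w : Fin r → Fin c → ℂ), (∀ q, tanMap (px s) (py s) (pz s) τ q +
        ∑ n, Fin.snoc (α := fun _ => ℂ) (w n) 0 q.2.2 *
          (px s i₀ q.1 * Pi.single (M := fun _ => ℂ) (φ n) 1 q.2.1) = 0) → τ = 0 ∧ w = 0 := by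
  have hk : 0 < k := i₀.pos
  have ht₀ : 0 < t₀ := Nat.pos_of_ne_zero fun h => by subst h; omega
  let l (i : Fin k) : Option (Fin P) :=
    if i = i₀ then none else some ⟨i.1 / t₀, Nat.div_lt_of_lt_mul (by rw [mul_comm]; omega)⟩
  obtain ⟨s, hs, hs'⟩ := ((gen_slices hP l
    (card_fiber_le l (fun i p h => by
      by_cases hi : i = i₀
      · simp [l, hi] at h
      · simp only [l, if_neg hi, Option.some.injEq] at h
        exact congrArg Fin.val h) ht₀) i₀ φ
    hφ hφt hA hB (.inr (by simp [l])) hcard).and (gen_last_slice i₀ hab)).exists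
  refine ⟨mkPar (px s) (py s) (fun i => Fin.snoc (cutZ l (pz s) i) (if i = i₀ then 1 else 0)),
    fun τ w h => ?_⟩
  obtain ⟨h1, h2, h3⟩ := hs (fun i m => (τ i).1 m.castSucc) w (fun i => (τ i).2.1)
    (fun i => (τ i).2.2)
    (fun i => mem_zeroSum.1 (τ i).2.1.2) (fun i => mem_zeroSum.1 (τ i).2.2.2)
    (fun a b m => by
      have := h (a, b, m.castSucc)
      simpa [tanMap_apply, tanSum] using this)
  obtain ⟨h4, h5, h6⟩ := hs' (fun i => (τ i).1 (Fin.last c)) (τ i₀).2.1 (τ i₀).2.2 (fun i j => by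
    have := h (i, j, Fin.last c)
    simpa [tanMap_apply, tanSum, Finset.sum_add_distrib] using this)
  refine ⟨TanCoord.eq_zero ?_ fun i => ?_, h2⟩
  · ext i m
    induction m using Fin.lastCases with
    | last => exact congrFun h4 i
    | cast m => exact congrFun (congrFun h1 i) m
  · by_cases hi : i = i₀
    · rw [hi, h5, h6]
      exact ⟨rfl, rfl⟩
    · exact h3 i (by simp [l, hi])

end TangentMap

section ParameterCounts

lemma PolyFun.comap {σ τ : Type*} {f : (σ → ℂ) → ℂ} (hf : PolyFun f) (g : σ → τ) :
    PolyFun (fun s : τ → ℂ => f (fun i => s (g i))) := by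
  obtain ⟨P, hP⟩ := hf
  exact ⟨rename g P, fun s => by rw [eval_rename, hP]; rfl⟩

variable {κ α β γ ε : Type*} [Fintype κ] [Fintype α] [Fintype β] [Fintype ε]

lemma finrank_tanCoord [Fintype γ] [Nonempty α] [Nonempty β] :
    Module.finrank ℂ (TanCoord κ α β γ) + 2 * Fintype.card κ =
      Fintype.card κ * (Fintype.card α + Fintype.card β + Fintype.card γ) := by
  have h1 := finrank_zeroSum α
  have h2 := finrank_zeroSum β
  rw [Module.finrank_pi_fintype]
  simp only [Module.finrank_prod, Module.finrank_fintype_fun_eq_card, Finset.sum_const,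
    Finset.card_univ, smul_eq_mul]
  rw [← h1, ← h2]
  ring

/-- The coordinates of the pure tensor `x ⊗ y ⊗ z`. -/
def ten (x : α → ℂ) (y : β → ℂ) (z : γ → ℂ) (q : α × β × γ) : ℂ := x q.1 * y q.2.1 * z q.2.2

/-- Coordinates for a family of points together with a family of extra tensors. -/
abbrev ParExt (κ α β γ ε : Type*) := Par κ α β γ ⊕ (ε × (α × β × γ))

/-- The points of a parameter. -/
def pts (s : ParExt κ α β γ ε → ℂ) : Par κ α β γ → ℂ := fun i => s (.inl i)

/-- The extra tensors of a parameter. -/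
def ext (s : ParExt κ α β γ ε → ℂ) (j : ε) (q : α × β × γ) : ℂ := s (.inr (j, q))

/-- The parametrization of the span of the tangent spaces and the extra tensors. -/
def extMap (s : ParExt κ α β γ ε → ℂ) (τ : TanCoord κ α β γ) (μ : ε → ℂ) : α × β × γ → ℂ :=
  tanMap (px (pts s)) (py (pts s)) (pz (pts s)) τ + ∑ j, μ j • ext s j

lemma polyFun_extMap (τ : TanCoord κ α β γ) (μ : ε → ℂ) (q : α × β × γ) :
    PolyFun (fun s : ParExt κ α β γ ε → ℂ => extMap s τ μ q) := by
  simp only [extMap, Pi.add_apply, Finset.sum_apply, Pi.smul_apply, smul_eq_mul]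
  exact ((polyFun_tanMap τ q).comap Sum.inl).add
    (PolyFun.sum _ fun j _ => (PolyFun.const _).mul (.coord _))

/-- Generically the tensors `x ⊗ y ⊗ v` in the span of the tangent spaces and the extra tensors
lie in the span of the tangent spaces. -/
lemma gen_extra_eq_zero [Fintype γ] [Nonempty α] [Nonempty β] (v : γ → ℂ)
    (hcard : Fintype.card ε + Module.finrank ℂ (TanCoord κ α β γ) +
      (Fintype.card α + Fintype.card β) ≤ Fintype.card α * (Fintype.card β * Fintype.card γ)) :
    Gen (fun s : ParExt κ α β γ ε → ℂ => ∀ x y τ μ, ten x y v = extMap s τ μ → μ = 0) := by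
  classical
  suffices H : ∀ n : ε, Gen (fun s : ParExt κ α β γ ε → ℂ =>
      ∀ x y τ μ, ten x y v = extMap s τ μ → μ n = 0) from
    (Gen.forall H).mono fun s hs x y τ μ h => funext fun n => hs n x y τ μ h
  intro n
  let N := Module.finrank ℂ (TanCoord κ α β γ)
  let B : Module.Basis (Fin N) ℂ (TanCoord κ α β γ) := Module.finBasis ℂ _
  let R := {j : ε // j ≠ n}
  let σ := Par κ α β γ ⊕ (R × (α × β × γ)) ⊕ R ⊕ Fin N ⊕ α ⊕ β
  let f (s : σ → ℂ) : ParExt κ α β γ ε → ℂ := Sum.elim (fun i => s (.inl i)) fun jq =>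
    if h : jq.1 ≠ n then s (.inr (.inl (⟨jq.1, h⟩, jq.2))) else
      s (.inr (.inr (.inr (.inr (.inl jq.2.1))))) *
        s (.inr (.inr (.inr (.inr (.inr jq.2.2.1))))) * v jq.2.2.2
      - ∑ i, s (.inr (.inr (.inr (.inl i)))) *
        tanMap (px fun i => s (.inl i)) (py fun i => s (.inl i)) (pz fun i => s (.inl i))
          (B i) jq.2
      - ∑ j : R, s (.inr (.inr (.inl j))) * s (.inr (.inl (j, jq.2)))
  have hf (j) : PolyFun (fun s => f s j) := by
    rcases j with i | ⟨j, q⟩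
    · exact .coord _
    · by_cases h : j ≠ n
      · simp only [f, Sum.elim_inr, dif_pos h]
        exact .coord _
      · simp only [f, Sum.elim_inr, dif_neg h]
        exact ((((PolyFun.coord _).mul (.coord _)).mul (.const _)).sub
          (PolyFun.sum _ fun i _ => (PolyFun.coord _).mul
            ((polyFun_tanMap (B i) q).comap Sum.inl))).sub
          (PolyFun.sum _ fun j _ => (PolyFun.coord _).mul (.coord _))
  have hR : Fintype.card R + 1 = Fintype.card ε := by
    have : 0 < Fintype.card ε := Fintype.card_pos_iff.2 ⟨n⟩
    simp only [R, Fintype.card_subtype_compl, Fintype.card_subtype_eq]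
    omega
  refine (Gen.not_mem_image ?_ f hf).mono fun s hs x y τ μ h => ?_
  · simp only [σ, Nat.card_eq_fintype_card, Fintype.card_sum, Fintype.card_prod,
      Fintype.card_fin, ← hR, add_mul, one_mul]
    omega
  · by_contra hμ
    refine hs (Sum.elim (fun i => s (.inl i)) (Sum.elim (fun jq => s (.inr (jq.1.1, jq.2)))
      (Sum.elim (fun j => (μ n)⁻¹ * μ j) (Sum.elim (fun i => (μ n)⁻¹ * B.repr τ i)
        (Sum.elim (fun i => (μ n)⁻¹ * x i) y))))) ?_
    ext j
    rcases j with i | ⟨j, q⟩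
    · rfl
    by_cases hj : j ≠ n
    · simp [f, hj]
    obtain rfl : j = n := not_not.1 hj
    have hq := congrFun h q
    have hτ : tanMap (px (pts s)) (py (pts s)) (pz (pts s)) τ q =
        ∑ i, B.repr τ i * tanMap (px (pts s)) (py (pts s)) (pz (pts s)) (B i) q := by
      conv_lhs => rw [← B.sum_repr τ]
      simp only [map_sum, map_smul, Finset.sum_apply, Pi.smul_apply, smul_eq_mul]
    simp only [extMap, Pi.add_apply, Finset.sum_apply, Pi.smul_apply, smul_eq_mul, hτ, ten] at hq
    rw [← Finset.add_sum_erase _ _ (Finset.mem_univ j),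
      Finset.sum_subtype (Finset.univ.erase j) (p := (· ≠ j)) (by simp)] at hq
    simp only [f, Sum.elim_inr, Sum.elim_inl, dif_neg hj, mul_assoc, ← Finset.mul_sum]
    change (μ j)⁻¹ * (x q.1 * (y q.2.1 * v q.2.2)) - (μ j)⁻¹ * ∑ i, B.repr τ i *
      tanMap (px (pts s)) (py (pts s)) (pz (pts s)) (B i) q - (μ j)⁻¹ * ∑ i : R, μ i * ext s i q =
        ext s j q
    rw [← mul_sub, ← mul_sub, ← mul_assoc, hq, inv_mul_eq_iff_eq_mul₀ hμ]
    ring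

/-- Parameter count for the rank one matrices in the span of generic rank one matrices
`x_i ⊗ y_i`, where enough of them are used. -/
lemma gen_trisecant_sum {R : Type*} [Fintype R]
    (hcard : Fintype.card R + 2 * Fintype.card α + Fintype.card β <
      Fintype.card α * Fintype.card β) :
    Gen (fun s : Par (α ⊕ R) α β Empty → ℂ =>
      ∀ (x : α → ℂ) (y : β → ℂ) (l : α ⊕ R → ℂ), (∀ a, l (.inl a) ≠ 0) → ¬ ∀ a b, x a * y b = ∑ i, l i * (px s i a * py s i b)) := by
  classical
  let σ := (α × α) ⊕ (R × α) ⊕ (R × β) ⊕ R ⊕ α ⊕ α ⊕ β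
  let f (s : σ → ℂ) : Par (α ⊕ R) α β Empty → ℂ := mkPar
    (Sum.elim (fun i a => s (.inl (i, a)))
      fun j a => ∑ i, s (.inr (.inl (j, i))) * s (.inl (i, a)))
    (Sum.elim (fun i b => s (.inr (.inr (.inr (.inr (.inl i))))) *
        (s (.inr (.inr (.inr (.inr (.inr (.inl i)))))) *
          s (.inr (.inr (.inr (.inr (.inr (.inr b)))))) -
        ∑ j, s (.inr (.inr (.inr (.inl j)))) * (s (.inr (.inl (j, i))) *
          s (.inr (.inr (.inl (j, b)))))))
      fun j b => s (.inr (.inr (.inl (j, b)))))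
    (fun _ => Empty.elim)
  have hf (q) : PolyFun (fun s => f s q) := by
    rcases q with ⟨i | j, a | b | e⟩
    · exact .coord _
    · exact (PolyFun.coord _).mul (((PolyFun.coord _).mul (.coord _)).sub
        (PolyFun.sum _ fun j _ => (PolyFun.coord _).mul ((PolyFun.coord _).mul (.coord _))))
    · exact e.elim
    · exact PolyFun.sum _ fun i _ => (PolyFun.coord _).mul (.coord _)
    · exact .coord _
    · exact e.elim
  let Λ (s : Par (α ⊕ R) α β Empty → ℂ) : (α → ℂ) →ₗ[ℂ] (α → ℂ) :=
    { toFun := fun u a => ∑ i, u i * px s (.inl i) a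
      map_add' := fun u v => by ext; simp [add_mul, Finset.sum_add_distrib]
      map_smul' := fun u v => by ext; simp [mul_assoc, Finset.mul_sum] }
  have hΛ : Gen (fun s => ∀ v, Λ s v = 0 → v = 0) := by
    refine Gen.injective Λ (fun v q => PolyFun.sum _ fun j _ => (PolyFun.const _).mul (.px _ _))
      (mkPar (Sum.elim (fun i => Pi.single i 1) 0) 0 0) fun v hv => funext fun i => ?_
    simpa [Λ, Pi.single_apply] using congrFun hv i
  refine ((Gen.not_mem_image ?_ f hf).and hΛ).mono fun s ⟨hs, hs'⟩ x y l hl h => ?_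
  · simp only [σ, Nat.card_eq_fintype_card, Fintype.card_sum, Fintype.card_prod,
      Fintype.card_empty]
    nlinarith
  · have hinj : Function.Injective (Λ s) := LinearMap.ker_eq_bot.1 (LinearMap.ker_eq_bot'.2 hs')
    have hsurj := LinearMap.surjective_of_injective hinj
    obtain ⟨x', hx'⟩ := hsurj x
    choose X' hX' using fun j => hsurj (px s (.inr j))
    refine hs (Sum.elim (fun q => px s (.inl q.1) q.2) (Sum.elim (fun q => X' q.1 q.2)
      (Sum.elim (fun q => py s (.inr q.1) q.2) (Sum.elim (fun j => l (.inr j))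
        (Sum.elim (fun i => (l (.inl i))⁻¹) (Sum.elim x' y)))))) ?_
    ext q
    rcases q with ⟨i | j, a | b | e⟩
    · rfl
    · have hb : (fun i => x' i * y b - (l (.inl i) * py s (.inl i) b +
          ∑ j, l (.inr j) * (X' j i * py s (.inr j) b))) = 0 := by
        refine hs' _ (funext fun a => ?_)
        have hab := h a b
        rw [← hx', Fintype.sum_sum_type] at hab
        simp only [← hX'] at hab
        simp only [Λ, LinearMap.coe_mk, AddHom.coe_mk, Pi.zero_apply] at hab ⊢
        simp only [sub_mul, add_mul, Finset.sum_sub_distrib, Finset.sum_add_distrib,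
          Finset.sum_mul] at hab ⊢
        rw [Finset.sum_comm (γ := α)]
        simp only [Finset.mul_sum] at hab
        rw [sub_eq_zero]
        refine Eq.trans ?_ (hab.trans ?_)
        · exact Finset.sum_congr rfl fun i _ => by ring
        · congr 1
          · exact Finset.sum_congr rfl fun i _ => by ring
          · exact Finset.sum_congr rfl fun i _ => Finset.sum_congr rfl fun i _ => by ring
      have hi := congrFun hb i
      rw [Pi.zero_apply] at hi
      change (l (.inl i))⁻¹ * (x' i * y b - ∑ j, l (.inr j) * (X' j i * py s (.inr j) b)) =
        py s (.inl i) b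
      rw [inv_mul_eq_iff_eq_mul₀ (hl i)]
      linear_combination hi
    · exact e.elim
    · exact congrFun (hX' j) a
    · rfl
    · exact e.elim

/-- A nonzero rank one matrix in the span of generic rank one matrices is proportional to one of
them. -/
lemma gen_trisecant [DecidableEq κ]
    (hcard : Fintype.card κ + Fintype.card α + Fintype.card β <
      Fintype.card α * Fintype.card β) :
    Gen (fun s : Par κ α β γ → ℂ => ∀ (x : α → ℂ) (y : β → ℂ) (l : κ → ℂ), x ≠ 0 → y ≠ 0 →
      (∀ a b, x a * y b = ∑ i, l i * (px s i a * py s i b)) → ∃ i, ∀ j ≠ i, l j = 0) := by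
  classical
  suffices H : ∀ S : Finset κ, 1 < S.card → Gen (fun s : Par κ α β γ → ℂ =>
      ∀ (x : α → ℂ) (y : β → ℂ) (l : κ → ℂ), x ≠ 0 → y ≠ 0 → (∀ i, i ∈ S ↔ l i ≠ 0) →
      ¬ ∀ a b, x a * y b = ∑ i, l i * (px s i a * py s i b)) by
    refine (Gen.forall fun S : {S : Finset κ // 1 < S.card} => H S.1 S.2).mono
      fun s hs x y l hx hy h => ?_
    by_cases hl : 1 < (Finset.univ.filter fun i => l i ≠ 0).card
    · exact absurd h (hs ⟨_, hl⟩ x y l hx hy (by simp))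
    · obtain ⟨a, ha⟩ := Function.ne_iff.1 hx
      obtain ⟨b, hb⟩ := Function.ne_iff.1 hy
      have h1 : ∃ i, l i ≠ 0 := by
        by_contra! hl'
        exact mul_ne_zero ha hb (by rw [h]; simp [hl'])
      obtain ⟨i, hi⟩ := h1
      refine ⟨i, fun j hj => ?_⟩
      by_contra hj'
      exact hl (Finset.one_lt_card.2 ⟨j, by simpa using hj', i, by simpa using hi, hj⟩)
  intro S hS
  by_cases hSA : S.card ≤ Fintype.card α
  · obtain ⟨g⟩ : Nonempty (S ↪ α) := Function.Embedding.nonempty_of_card_le (by simpa using hSA)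
    obtain ⟨i, hi, j, hj, hij⟩ := Finset.one_lt_card.1 hS
    obtain ⟨b₁, b₂, hb⟩ : ∃ b₁ b₂ : β, b₁ ≠ b₂ := by
      have : 1 < Fintype.card β := by
        by_contra! hB
        have := Nat.mul_le_mul_left (Fintype.card α) hB
        omega
      exact Fintype.one_lt_card_iff.1 this
    let Λ (s : Par κ α β γ → ℂ) : (S → ℂ) →ₗ[ℂ] (α → ℂ) :=
      { toFun := fun u a => ∑ i, u i * px s i a
        map_add' := fun u v => by ext; simp [add_mul, Finset.sum_add_distrib]
        map_smul' := fun u v => by ext; simp [mul_assoc, Finset.mul_sum] }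
    have hΛ : Gen (fun s => ∀ v, Λ s v = 0 → v = 0) := by
      refine Gen.injective Λ (fun v q => PolyFun.sum _ fun j _ => (PolyFun.const _).mul (.px _ _))
        (mkPar (fun i => if h : i ∈ S then Pi.single (g ⟨i, h⟩) 1 else 0) 0 0)
        fun v hv => funext fun i => ?_
      have := congrFun hv (g i)
      simpa [Λ, Pi.single_apply] using this
    have hdet : Gen (fun s : Par κ α β γ → ℂ =>
        py s i b₁ * py s j b₂ - py s i b₂ * py s j b₁ ≠ 0) :=
      PolyFun.gen_ne_zero (((PolyFun.py _ _).mul (.py _ _)).sub ((PolyFun.py _ _).mul (.py _ _)))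
        (mkPar 0 (fun n => if n = i then Pi.single b₁ 1 else Pi.single b₂ 1) 0)
        (by simp [hij.symm, hb])
    refine (hΛ.and hdet).mono fun s ⟨hs, hs'⟩ x y l hx hy hl h => hs' ?_
    obtain ⟨b, hb⟩ := Function.ne_iff.1 hy
    have key (b') (n) (hn : n ∈ S) : y b * py s n b' = y b' * py s n b := by
      have := hs (fun n => l n * (y b * py s n b' - y b' * py s n b)) (funext fun a => ?_)
      · have := congrFun this ⟨n, hn⟩
        simp only [Pi.zero_apply, mul_eq_zero, (hl n).1 hn, false_or] at this
        exact sub_eq_zero.1 this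
      · have h1 (b) : x a * y b = ∑ i : S, l i * (px s i a * py s i b) := by
          rw [h, ← Finset.sum_subset (Finset.subset_univ S), ← Finset.sum_coe_sort S]
          intro n _ hn
          rw [not_not.1 (mt (hl n).2 hn), zero_mul]
        have h2 : y b * (x a * y b') - y b' * (x a * y b) = 0 := by ring
        rw [h1, h1, Finset.mul_sum, Finset.mul_sum, ← Finset.sum_sub_distrib] at h2
        refine Eq.trans ?_ h2
        exact Finset.sum_congr rfl fun i _ => by ring
    have h1 := key b₁ i hi
    have h2 := key b₂ i hi
    have h3 := key b₁ j hj
    have h4 := key b₂ j hj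
    refine (mul_eq_zero.1 (?_ : y b * y b * _ = 0)).resolve_left (mul_ne_zero hb hb)
    linear_combination (y b * py s j b₂) * h1 + (y b₁ * py s i b) * h4 - (y b * py s j b₁) * h2
      - (y b₂ * py s i b) * h3
  · obtain ⟨g⟩ : Nonempty (α ↪ S) := Function.Embedding.nonempty_of_card_le (by simp; omega)
    let g' : α ↪ κ := g.trans (.subtype _)
    let R := {i : κ // i ∉ Set.range g'}
    let e : α ⊕ R ≃ κ := ((Equiv.ofInjective g' g'.injective).sumCongr (Equiv.refl _)).trans
      (Equiv.sumCompl (· ∈ Set.range g'))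
    have he (a) : e (.inl a) ∈ S := (g a).2
    have hR : Fintype.card α + Fintype.card R = Fintype.card κ := by
      rw [← Fintype.card_congr e, Fintype.card_sum]
    refine ((gen_trisecant_sum (α := α) (β := β) (R := R) (by omega)).comap
      (τ := Par κ α β γ) (Prod.map e (Sum.map id (Sum.map id Empty.elim)))
      (e.injective.prodMap (Sum.map_injective.2 ⟨Function.injective_id,
        Sum.map_injective.2 ⟨Function.injective_id, fun i => i.elim⟩⟩))).mono
      fun s hs x y l hx hy hl h => ?_
    refine hs x y (fun i => l (e i)) (fun a => (hl _).1 (he a)) fun a b => ?_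
    rw [h, ← e.sum_comp]
    rfl

end ParameterCounts

section Main

lemma exists_independent_mod {V : Type*} [AddCommGroup V] [Module ℂ V] [FiniteDimensional ℂ V]
    {T K : Submodule ℂ V} (hTK : T ≤ K) {e : ℕ}
    (h : Module.finrank ℂ T + e ≤ Module.finrank ℂ K) :
    ∃ f : Fin e → V, (∀ j, f j ∈ K) ∧ ∀ μ : Fin e → ℂ, ∑ j, μ j • f j ∈ T → μ = 0 := by
  obtain ⟨W, hW⟩ := T.exists_isCompl
  have hsup : T ⊔ W ⊓ K = K := by rw [← sup_inf_assoc_of_le W hTK, hW.sup_eq_top, top_inf_eq]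
  have hrank := Submodule.finrank_sup_add_finrank_inf_eq T (W ⊓ K)
  have hinf : T ⊓ (W ⊓ K) = ⊥ := by rw [← inf_assoc, hW.inf_eq_bot, bot_inf_eq]
  rw [hsup, hinf, finrank_bot] at hrank
  obtain ⟨f, hf⟩ := exists_linearIndependent_of_le_finrank
    (show e ≤ Module.finrank ℂ (W ⊓ K : Submodule ℂ V) by omega)
  refine ⟨fun j => f j, fun j => (f j).2.2, fun μ hμ => ?_⟩
  have hW' : ∑ j, μ j • (f j : V) ∈ T ⊓ W :=
    ⟨hμ, W.sum_mem fun j _ => W.smul_mem _ (f j).2.1⟩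
  rw [hW.inf_eq_bot, Submodule.mem_bot] at hW'
  exact funext (Fintype.linearIndependent_iff.1 hf μ (Subtype.ext (by simpa using hW')))

section

variable {α β γ : Type*}

lemma ten_add (x : α → ℂ) (y : β → ℂ) (z z' : γ → ℂ) :
    ten x y (z + z') = ten x y z + ten x y z' := by
  ext q
  simp [ten, mul_add]

lemma ten_smul (v : ℂ) (x : α → ℂ) (y : β → ℂ) (z : γ → ℂ) :
    ten x y (v • z) = v • ten x y z := by
  ext q
  simp only [ten, Pi.smul_apply, smul_eq_mul]
  ring

lemma ten_smul₃ (u v w : ℂ) (x : α → ℂ) (y : β → ℂ) (z : γ → ℂ) :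
    ten (u • x) (v • y) (w • z) = (u * v * w) • ten x y z := by
  ext q
  simp only [ten, Pi.smul_apply, smul_eq_mul]
  ring

end

section

variable {κ α β γ ε : Type*} [Fintype κ] [Fintype α] [Fintype β] [Fintype ε]

lemma extMap_add (s : ParExt κ α β γ ε → ℂ) (τ τ' : TanCoord κ α β γ) (μ μ' : ε → ℂ) :
    extMap s (τ + τ') (μ + μ') = extMap s τ μ + extMap s τ' μ' := by
  simp only [extMap, map_add, Pi.add_apply, add_smul, Finset.sum_add_distrib]
  abel

lemma extMap_smul (s : ParExt κ α β γ ε → ℂ) (v : ℂ) (τ : TanCoord κ α β γ) (μ : ε → ℂ) :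
    extMap s (v • τ) (v • μ) = v • extMap s τ μ := by
  simp only [extMap, map_smul, Pi.smul_apply, smul_add, Finset.smul_sum, smul_eq_mul, mul_smul]

end

variable {k a b c r e P t₀ : ℕ}

/-- Generically the tensors `x_{i₀} ⊗ e_{φ n} ⊗ z` lie in the span of the tangent spaces and the
extra tensors for all `n` only if `z` is proportional to `z_{i₀}`. -/
lemma gen_common_kernel (i₀ : Fin k) (hP : 2 * P ≤ c) (hkP : k ≤ P * t₀)
    (hA : t₀ < a + 1) (hB : t₀ < b + 1) (hab : k ≤ a * b + 1)
    (φ : Fin r → Fin (b + 1)) (hφ : Function.Injective φ) (hφt : ∀ n, t₀ < (φ n).1)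
    (hcard : ∀ t ≤ t₀, k + r ≤ (a + 1 - t) * (b + 1 - t) + t / 2 * (a + 1 - t + (b + 1 - t)) + t)
    {m : ℕ} (g : Fin c ↪ Fin r × Fin m)
    (he : Module.finrank ℂ (TanCoord (Fin k) (Fin (a + 1)) (Fin (b + 1)) (Fin (c + 1))) + e + m ≤
      (a + 1) * ((b + 1) * (c + 1))) :
    Gen (fun s : ParExt (Fin k) (Fin (a + 1)) (Fin (b + 1)) (Fin (c + 1)) (Fin e) → ℂ =>
      ∀ (τ : Fin r → TanCoord (Fin k) (Fin (a + 1)) (Fin (b + 1)) (Fin (c + 1)))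
        (μ : Fin r → Fin e → ℂ) (z : Fin c → ℂ),
        (∀ n, extMap s (τ n) (μ n) + ten (px (pts s) i₀) (Pi.single (φ n) 1)
          (Fin.snoc (α := fun _ => ℂ) z 0) = 0) → τ = 0 ∧ μ = 0 ∧ z = 0) := by
  classical
  obtain ⟨s, hs⟩ := exists_tanMap_add_injective i₀ hP hkP hA hB hab φ hφ hφt hcard
  let Z (z : Fin c → ℂ) : Fin (c + 1) → ℂ := Fin.snoc (α := fun _ => ℂ) z 0
  have hZadd (z z') : Z (z + z') = Z z + Z z' := by
    ext l
    induction l using Fin.lastCases <;> simp [Z]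
  have hZsmul (v : ℂ) (z) : Z (v • z) = v • Z z := by
    ext l
    induction l using Fin.lastCases <;> simp [Z]
  let Λ (s : ParExt (Fin k) (Fin (a + 1)) (Fin (b + 1)) (Fin (c + 1)) (Fin e) → ℂ) :
      (Fin r → TanCoord (Fin k) (Fin (a + 1)) (Fin (b + 1)) (Fin (c + 1))) ×
        (Fin r → Fin e → ℂ) × (Fin c → ℂ) →ₗ[ℂ]
        (Fin r × (Fin (a + 1) × Fin (b + 1) × Fin (c + 1)) → ℂ) :=
    { toFun := fun v q => (extMap s (v.1 q.1) (v.2.1 q.1) + ten (px (pts s) i₀)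
        (Pi.single (φ q.1) 1) (Z v.2.2)) q.2
      map_add' := fun v v' => by
        ext q
        simp only [Prod.fst_add, Prod.snd_add, Pi.add_apply, extMap_add, hZadd, ten_add]
        ring
      map_smul' := fun v v' => by
        ext q
        simp only [Prod.smul_fst, Prod.smul_snd, Pi.smul_apply, Pi.add_apply, extMap_smul, hZsmul,
          ten_smul, smul_eq_mul, RingHom.id_apply, mul_add] }
  have hΛ (v q) : PolyFun (fun s => Λ s v q) :=
    (polyFun_extMap _ _ _).add ((((PolyFun.px _ _).comap Sum.inl).mul (.const _)).mul (.const _))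
  let Ψ : TanCoord (Fin k) (Fin (a + 1)) (Fin (b + 1)) (Fin (c + 1)) × (Fin r → Fin c → ℂ) →ₗ[ℂ]
      (Fin (a + 1) × Fin (b + 1) × Fin (c + 1) → ℂ) :=
    { toFun := fun v => tanMap (px s) (py s) (pz s) v.1 +
        ∑ n, ten (px s i₀) (Pi.single (φ n) 1) (Z (v.2 n))
      map_add' := fun v v' => by
        simp only [Prod.fst_add, Prod.snd_add, Pi.add_apply, map_add, hZadd, ten_add,
          Finset.sum_add_distrib]
        abel
      map_smul' := fun v v' => by
        simp only [Prod.smul_fst, Prod.smul_snd, Pi.smul_apply, map_smul, hZsmul, ten_smul,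
          smul_add, RingHom.id_apply, Finset.smul_sum] }
  obtain ⟨N, hN⟩ := Ψ.exists_leftInverse_of_injective (LinearMap.ker_eq_bot'.2 fun v hv => by
    obtain ⟨h1, h2⟩ := hs v.1 v.2 fun q => by
      have := congrFun hv q
      simp only [Ψ, LinearMap.coe_mk, AddHom.coe_mk, Pi.add_apply, Finset.sum_apply, ten,
        Pi.zero_apply] at this
      refine Eq.trans ?_ this
      congr 1
      exact Finset.sum_congr rfl fun n _ => by ring
    exact Prod.ext h1 h2)
  have hN' (v) : N (Ψ v) = v := by rw [← LinearMap.comp_apply, hN, LinearMap.id_apply]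
  let u₀ : (Fin r → Fin c → ℂ) →ₗ[ℂ] (Fin m → ℂ) :=
    ∑ l, LinearMap.single ℂ (fun _ => ℂ) (g l).2 ∘ₗ LinearMap.proj l ∘ₗ LinearMap.proj (g l).1
  let u := u₀ ∘ₗ LinearMap.snd ℂ _ _ ∘ₗ N
  have hΨ1 (τ) : tanMap (px s) (py s) (pz s) τ = Ψ (τ, 0) := by
    have : Z 0 = 0 := by simpa using hZsmul 0 0
    have h0 (n) : ten (px s i₀) (Pi.single (φ n) 1) (0 : Fin (c + 1) → ℂ) = 0 := by
      ext q
      simp [ten]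
    simp [Ψ, this, h0]
  have hΨ2 (n z) : ten (px s i₀) (Pi.single (φ n) 1) (Z z) = Ψ (0, Pi.single n z) := by
    simp only [Ψ, LinearMap.coe_mk, AddHom.coe_mk, map_zero, zero_add]
    rw [Finset.sum_eq_single n]
    · simp
    · intro n' _ hn
      rw [Pi.single_eq_of_ne hn, show Z 0 = 0 by simpa using hZsmul 0 0]
      ext q
      simp [ten]
    · simp
  have hT : LinearMap.range (tanMap (px s) (py s) (pz s)) ≤ LinearMap.ker u := by
    rintro _ ⟨τ, rfl⟩
    rw [hΨ1]
    simp [u, hN']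
  have htan : Function.Injective (tanMap (px s) (py s) (pz s)) :=
    LinearMap.ker_eq_bot.1 (LinearMap.ker_eq_bot'.2 fun τ hτ => by
      rw [hΨ1] at hτ
      have := hN' (τ, 0)
      rw [hτ, map_zero] at this
      exact (Prod.ext_iff.1 this).1.symm)
  obtain ⟨f, hfK, hf⟩ := exists_independent_mod (e := e) hT (by
    have h1 := LinearMap.finrank_range_add_finrank_ker u
    have h2 := Submodule.finrank_le (LinearMap.range u)
    rw [LinearMap.finrank_range_of_inj htan]
    simp only [Module.finrank_fintype_fun_eq_card, Fintype.card_prod, Fintype.card_fin] at h1 h2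
    omega)
  refine (Gen.injective Λ hΛ (Sum.elim s fun jq => f jq.1 jq.2) ?_).mono
    fun s' hs' τ μ z h => ?_
  · rintro ⟨τ, μ, z⟩ h
    have h' (n) : tanMap (px s) (py s) (pz s) (τ n) + ∑ j, μ n j • f j +
        ten (px s i₀) (Pi.single (φ n) 1) (Z z) = 0 := funext fun q => congrFun h (n, q)
    have hz : z = 0 := by
      ext l
      have h1 := congrFun (congrArg u (h' (g l).1)) (g l).2
      rw [map_add, map_add, hT ⟨_, rfl⟩, LinearMap.mem_ker.1 ((LinearMap.ker u).sum_mem fun j _ =>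
        (LinearMap.ker u).smul_mem _ (hfK j)), hΨ2, zero_add, zero_add, map_zero] at h1
      simp only [u, LinearMap.comp_apply, hN', LinearMap.snd_apply, u₀, LinearMap.sum_apply,
        Finset.sum_apply, LinearMap.proj_apply, LinearMap.single_apply] at h1
      rw [Finset.sum_eq_single l] at h1
      · simpa using h1
      · intro l' _ hl
        by_cases h1 : (g l').1 = (g l).1
        · rw [Pi.single_eq_of_ne]
          exact fun h2 => hl (g.injective (Prod.ext h1 h2.symm))
        · simp [Pi.single_eq_of_ne h1]
      · simp
    have hμ (n) : μ n = 0 := by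
      refine hf _ ⟨-τ n, ?_⟩
      have := h' n
      rw [hz, hΨ2, Pi.single_zero, Prod.mk_zero_zero, map_zero, add_zero] at this
      rw [map_neg, neg_eq_iff_add_eq_zero, this]
    refine Prod.ext (funext fun n => htan ?_) (Prod.ext (funext hμ) hz)
    have := h' n
    rw [hz, hΨ2, Pi.single_zero, Prod.mk_zero_zero, map_zero, add_zero, hμ] at this
    simpa using this
  · have := hs' (τ, μ, z) (funext fun q => congrFun (h q.1) q.2)
    simpa using this

section

variable {κ α β γ : Type*} [Fintype κ] [DecidableEq κ] [Fintype α] [Fintype β]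
  (x : κ → α → ℂ) (y : κ → β → ℂ) (z : κ → γ → ℂ) (i : κ)

lemma tanMap_single (τ : (γ → ℂ) × zeroSum β × zeroSum α) :
    tanMap x y z (Pi.single i τ) =
      ten (x i) (y i) τ.1 + ten (x i) τ.2.1 (z i) + ten τ.2.2 (y i) (z i) := by
  ext q
  rw [tanMap_apply, tanSum, Finset.sum_eq_single i]
  · simp only [Pi.single_eq_same, ten, Pi.add_apply]
    ring
  · intro j _ hj
    simp [Pi.single_eq_of_ne hj]
  · simp

lemma exists_tanMap_eq_fst (hx : ∑ n, x i n ≠ 0) (v : α → ℂ) :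
    ∃ τ, tanMap x y z τ = ten v (y i) (z i) := by
  let t := (∑ n, v n) / ∑ n, x i n
  refine ⟨Pi.single i (t • z i, 0, ⟨v - t • x i, mem_zeroSum.2 ?_⟩), ?_⟩
  · simp [← Finset.mul_sum, t, hx]
  · rw [tanMap_single]
    ext q
    simp only [ten, Pi.add_apply, Pi.sub_apply, Pi.smul_apply, smul_eq_mul, Submodule.coe_zero,
      Pi.zero_apply]
    ring

lemma exists_tanMap_eq_snd (hy : ∑ n, y i n ≠ 0) (v : β → ℂ) :
    ∃ τ, tanMap x y z τ = ten (x i) v (z i) := by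
  let t := (∑ n, v n) / ∑ n, y i n
  refine ⟨Pi.single i (t • z i, ⟨v - t • y i, mem_zeroSum.2 ?_⟩, 0), ?_⟩
  · simp [← Finset.mul_sum, t, hy]
  · rw [tanMap_single]
    ext q
    simp only [ten, Pi.add_apply, Pi.sub_apply, Pi.smul_apply, smul_eq_mul, Submodule.coe_zero,
      Pi.zero_apply]
    ring

end

/-- The main theorem in coordinates. -/
lemma gen_tangent (hk : 0 < k) (hP : 2 * P ≤ c) (hkP : k ≤ P * t₀) (hA : t₀ < a + 1)
    (hab : k ≤ a * b + 1) (hr : 0 < r) (hrb : t₀ + r ≤ b) (hrc : c ≤ r * (a + 1 + (b + 1)))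
    (hcard : ∀ t ≤ t₀, k + r ≤ (a + 1 - t) * (b + 1 - t) + t / 2 * (a + 1 - t + (b + 1 - t)) + t)
    (htri : k + (a + 1) + (b + 1) < (a + 1) * (b + 1))
    (he : Module.finrank ℂ (TanCoord (Fin k) (Fin (a + 1)) (Fin (b + 1)) (Fin (c + 1))) + e +
      (a + 1 + (b + 1)) ≤ (a + 1) * ((b + 1) * (c + 1))) :
    Gen (fun s : ParExt (Fin k) (Fin (a + 1)) (Fin (b + 1)) (Fin (c + 1)) (Fin e) → ℂ =>
      (∀ i, ∑ n, px (pts s) i n ≠ 0 ∧ ∑ n, py (pts s) i n ≠ 0) ∧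
      (∀ τ μ, extMap s τ μ = 0 → τ = 0 ∧ μ = 0) ∧
      ∀ x y z, x ≠ 0 → y ≠ 0 → (∀ v, ∃ τ μ, ten x y v = extMap s τ μ) →
        (∀ v, ∃ τ μ, ten x v z = extMap s τ μ) →
        ∃ i, ∃ t : ℂ, ten x y z = t • ten (px (pts s) i) (py (pts s) i) (pz (pts s) i)) := by
  classical
  let φ (n : Fin r) : Fin (b + 1) := ⟨b - n, by omega⟩
  have hφ : Function.Injective φ := fun n n' h => by
    have := congrArg Fin.val h
    simp only [φ] at this
    ext
    omega
  obtain ⟨g⟩ : Nonempty (Fin c ↪ Fin r × Fin (a + 1 + (b + 1))) :=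
    Function.Embedding.nonempty_of_card_le (by simpa using hrc)
  have hker := Gen.forall fun i₀ : Fin k => gen_common_kernel (e := e) i₀ hP hkP hA (by omega) hab
    φ hφ (fun n => by simp only [φ]; omega) hcard g he
  have hext := gen_extra_eq_zero (κ := Fin k) (α := Fin (a + 1)) (β := Fin (b + 1)) (ε := Fin e)
    (Pi.single (Fin.last c) 1) (by simp only [Fintype.card_fin]; omega)
  have hinj := (gen_tanMap_injective (a := a + 1) (b := b + 1) hk hP hkP hA (by omega)
    fun t ht => (Nat.le_add_right _ _).trans (hcard t ht)).comap
      (τ := ParExt (Fin k) (Fin (a + 1)) (Fin (b + 1)) (Fin (c + 1)) (Fin e))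
      (fun q => .inl (Prod.map id (Sum.map id (Sum.map id Fin.castSucc)) q))
      (Sum.inl_injective.comp (Function.injective_id.prodMap (Sum.map_injective.2
        ⟨Function.injective_id, Sum.map_injective.2
          ⟨Function.injective_id, Fin.castSucc_injective c⟩⟩)))
  have htris := (gen_trisecant (κ := Fin k) (α := Fin (a + 1)) (β := Fin (b + 1))
    (γ := Fin (c + 1)) (by simpa using htri)).comap
      (τ := ParExt (Fin k) (Fin (a + 1)) (Fin (b + 1)) (Fin (c + 1)) (Fin e)) _
      Sum.inl_injective
  have hone : Gen (fun s : ParExt (Fin k) (Fin (a + 1)) (Fin (b + 1)) (Fin (c + 1)) (Fin e) → ℂ =>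
      ∀ i, (∑ n, px (pts s) i n ≠ 0 ∧ ∑ n, py (pts s) i n ≠ 0) ∧
        pz (pts s) i (Fin.last c) ≠ 0) := by
    refine Gen.forall fun i => ((PolyFun.gen_ne_zero ?_ (fun _ => 1) ?_).and
      (PolyFun.gen_ne_zero ?_ (fun _ => 1) ?_)).and (PolyFun.gen_ne_zero ?_ (fun _ => 1) ?_)
    · exact PolyFun.sum _ fun n _ => .coord _
    · simp only [px, pts, Finset.sum_const, Finset.card_univ, Fintype.card_fin]
      simpa using Nat.cast_add_one_ne_zero (R := ℂ) a
    · exact PolyFun.sum _ fun n _ => .coord _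
    · simp only [py, pts, Finset.sum_const, Finset.card_univ, Fintype.card_fin]
      simpa using Nat.cast_add_one_ne_zero (R := ℂ) b
    · exact .coord _
    · simp [pz, pts]
  refine ((hker.and hext).and ((hinj.and htris).and hone)).mono
    fun s ⟨⟨hker, hext⟩, ⟨hinj, htris⟩, hone⟩ => ⟨fun i => (hone i).1, fun τ μ h => ?_,
      fun x y z hx hy h1 h2 => ?_⟩
  · obtain ⟨h1, h2, -⟩ := hker ⟨0, hk⟩ (fun _ => τ) (fun _ => μ) 0 fun n => by
      rw [h, zero_add]
      ext q
      rcases q with ⟨i, j, l⟩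
      induction l using Fin.lastCases <;> simp [ten]
    exact ⟨congrFun h1 ⟨0, hr⟩, congrFun h2 ⟨0, hr⟩⟩
  · obtain ⟨τ, μ, hτ⟩ := h1 (Pi.single (Fin.last c) 1)
    obtain rfl := hext x y τ μ hτ
    have hτ' (i j l) : x i * y j * Pi.single (M := fun _ => ℂ) (Fin.last c) 1 l =
        tanSum (px (pts s)) (py (pts s)) (pz (pts s)) (fun i => (τ i).1) (fun i => (τ i).2.1)
      (fun i => (τ i).2.2) i j l := by
      have := congrFun hτ (i, j, l)
      simpa [extMap, ten, tanMap_apply] using this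
    have h0 := hinj (fun i => (fun l => (τ i).1 l.castSucc, (τ i).2)) (funext fun ⟨i, j, l⟩ => by
      have := hτ' i j l.castSucc
      rw [Pi.single_eq_of_ne (Fin.castSucc_ne_last l), mul_zero] at this
      exact this.symm)
    have h0' (i) : (τ i).2 = 0 := congrArg Prod.snd (congrFun h0 i)
    have hxy (i j) : x i * y j = ∑ n, (τ n).1 (Fin.last c) *
        (px (pts s) n i * py (pts s) n j) := by
      have := hτ' i j (Fin.last c)
      simpa [tanSum, h0'] using this
    obtain ⟨i, hi⟩ := htris x y _ hx hy hxy
    have hxy' (n m) : x n * y m = (τ i).1 (Fin.last c) * (px (pts s) i n * py (pts s) i m) := by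
      rw [hxy, Finset.sum_eq_single i (fun j _ hj => by rw [hi j hj, zero_mul]) (by simp)]
    obtain ⟨n₀, hn₀⟩ := Function.ne_iff.1 hx
    obtain ⟨m₀, hm₀⟩ := Function.ne_iff.1 hy
    rw [Pi.zero_apply] at hn₀ hm₀
    obtain ⟨u, hu⟩ : ∃ u : ℂ, x = u • px (pts s) i :=
      ⟨(τ i).1 (Fin.last c) * py (pts s) i m₀ / y m₀, funext fun n => by
        rw [Pi.smul_apply, smul_eq_mul, div_mul_eq_mul_div, eq_div_iff hm₀, hxy']
        ring⟩
    obtain ⟨v, hv⟩ : ∃ v : ℂ, y = v • py (pts s) i :=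
      ⟨(τ i).1 (Fin.last c) * px (pts s) i n₀ / x n₀, funext fun n => by
        rw [Pi.smul_apply, smul_eq_mul, div_mul_eq_mul_div, eq_div_iff hn₀, mul_comm, hxy']
        ring⟩
    have hu0 : u ≠ 0 := by
      rintro rfl
      exact hx (by rw [hu, zero_smul])
    let w := z (Fin.last c) / pz (pts s) i (Fin.last c)
    choose τ₁ hτ₁ using fun n : Fin r => exists_tanMap_eq_snd (px (pts s)) (py (pts s))
      (pz (pts s)) i (hone i).1.2 (Pi.single (φ n) 1)
    choose τ₂ μ₂ hτ₂ using fun n : Fin r => h2 (Pi.single (φ n) 1)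
    obtain ⟨-, -, h3⟩ := hker i (fun n => w • τ₁ n + -u⁻¹ • τ₂ n) (fun n => w • 0 + -u⁻¹ • μ₂ n)
      (fun l => z l.castSucc - w * pz (pts s) i l.castSucc) fun n => by
        rw [extMap_add, extMap_smul, extMap_smul, ← hτ₂]
        have : extMap s (τ₁ n) 0 = ten (px (pts s) i) (Pi.single (φ n) 1) (pz (pts s) i) := by
          simp [extMap, hτ₁]
        rw [this, hu]
        ext q
        rcases q with ⟨i', j, l⟩
        induction l using Fin.lastCases with
        | last =>
          simp only [ten, Pi.add_apply, Pi.smul_apply, smul_eq_mul, Fin.snoc_last, Pi.zero_apply,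
            w]
          field_simp [(hone i).2]
          ring
        | cast l =>
          simp only [ten, Pi.add_apply, Pi.smul_apply, smul_eq_mul, Fin.snoc_castSucc,
            Pi.zero_apply]
          field_simp
          ring
    have hz : z = w • pz (pts s) i := by
      ext l
      induction l using Fin.lastCases with
      | last => simp [w, (hone i).2]
      | cast l => exact sub_eq_zero.1 (congrFun h3 l)
    exact ⟨i, u * v * w, by rw [hu, hv, hz, ten_smul₃]⟩

end Main

section Numerics

variable {A B C k r s : ℤ}

lemma numeric_tangent (hA : 4 ≤ A) (hAB : A ≤ B) (hBC : B ≤ C)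
    (h : (k + C) * (A + B + C - 2) ≤ A * B * C) (hs : (C - 2) * (s - 1) ≤ 2 * (k - 1))
    (hr : (A + B) * (r - 1) ≤ C - 2) :
    (s + 1) * (A + B) - 4 * s + 2 * r ≤ 2 * (A * B - k) := by
  have hr' : r - 1 ≤ 0 ∨ C - 2 ≥ A + B := by
    by_contra! hc
    nlinarith
  have hD : 0 ≤ (A + B + C - 2) * (C * C + 3 * (A + B) - 8 - 4 * C - r * (C - 2)) +
      2 * (A * B) * (C + 2 - (A + B)) := by
    by_cases hS : A + B ≤ C + 2
    · have h1 : 8 * (r - 1) ≤ C - 2 := by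
        by_contra! hc
        nlinarith
      have h2 : 8 * r * (C - 2) ≤ (C + 6) * (C - 2) :=
        mul_le_mul_of_nonneg_right (by linarith) (by linarith)
      have h3 : 0 ≤ C * C + 3 * (A + B) - 8 - 4 * C - r * (C - 2) := by nlinarith
      have h4 : 0 ≤ A * B := by nlinarith
      have h5 : 0 ≤ 2 * (A * B) * (C + 2 - (A + B)) := mul_nonneg (by linarith) (by linarith)
      have h6 := mul_nonneg (show 0 ≤ A + B + C - 2 by linarith) h3
      linarith
    · have hr1 : r ≤ 1 := by
        rcases hr' with h | h <;> linarith
      have h1 : r * (C - 2) ≤ 1 * (C - 2) := mul_le_mul_of_nonneg_right hr1 (by linarith)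
      have h2 : 4 * (A * B) ≤ (A + B) * (2 * C) := by nlinarith [sq_nonneg (A - B)]
      obtain ⟨v, hv⟩ : ∃ v, A + B = C + 2 + v := ⟨A + B - C - 2, by ring⟩
      rw [hv] at h2 hS ⊢
      have hv0 : 0 ≤ v := by linarith
      have hvC : v ≤ C - 2 := by linarith
      have h3 : (C + 2 + v + C - 2) * (C * C - 2 * C + 3 * v) ≤
          (C + 2 + v + C - 2) * (C * C + 3 * (C + 2 + v) - 8 - 4 * C - r * (C - 2)) :=
        mul_le_mul_of_nonneg_left (by linarith) (by linarith)
      have h4 : 2 * (A * B) * v ≤ (C + 2 + v) * C * v :=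
        mul_le_mul_of_nonneg_right (by linarith) hv0
      have h5 : v * v ≤ (C - 2) * (C - 2) := mul_self_le_mul_self hv0 hvC
      have h6 : (C - 3) * (v * v) ≤ (C - 3) * ((C - 2) * (C - 2)) :=
        mul_le_mul_of_nonneg_left h5 (by linarith)
      nlinarith
  have hM : 0 ≤ A * B * (C - 2) + (A + B - 4) - k * (A + B + C - 2 - 4)
      - (A + B - 2 + r) * (C - 2) := by
    have h1 := mul_le_mul_of_nonneg_right h (show 0 ≤ A + B + C - 2 - 4 by linarith)
    refine nonneg_of_mul_nonneg_right (a := A + B + C - 2) ?_ (by linarith)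
    linarith
  have h1 := mul_le_mul_of_nonneg_right hs (show 0 ≤ A + B - 4 by linarith)
  have h2 : 0 ≤ (C - 2) * (2 * (A * B - k) - ((s + 1) * (A + B) - 4 * s + 2 * r)) := by linarith
  have := nonneg_of_mul_nonneg_right h2 (by linarith)
  linarith

lemma numeric_trisecant (hA : 4 ≤ A) (hAB : A ≤ B) (hBC : B ≤ C)
    (h : (k + C) * (A + B + C - 2) ≤ A * B * C) : k + A + B < A * B := by
  have h1 : 2 * (A + B) ≤ A * B := by nlinarith
  by_contra! hc
  have h2 := mul_le_mul_of_nonneg_right (show A * B - (A + B) ≤ k by linarith)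
    (show 0 ≤ A + B + C - 2 by linarith)
  have h3 := mul_le_mul_of_nonneg_right h1 (show 0 ≤ A + B - 2 by linarith)
  nlinarith

lemma numeric_fst (hA : 4 ≤ A) (hAB : A ≤ B) (hBC : B ≤ C)
    (h : (k + C) * (A + B + C - 2) ≤ A * B * C) : 2 * k ≤ (C - 2) * (A - 1) := by
  have h0 : (2 * k + 2 * C) * (A + B + C - 2) ≤
      ((C - 2) * (A - 1) + 2 * C) * (A + B + C - 2) := by
    have h1 : 0 ≤ (A - 2) * (C - 1) := mul_nonneg (by linarith) (by linarith)
    have h2 : 0 ≤ A * C * (C - B) := mul_nonneg (by nlinarith) (by linarith)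
    have h3 : (A + B + C - 2) * (2 * A - 2 - C) ≤ A * C * (A - 2) := by
      by_cases hC : 2 * A - 2 - C ≤ 0
      · have : 0 ≤ A * C * (A - 2) := mul_nonneg (by nlinarith) (by linarith)
        nlinarith
      · exact mul_le_mul (by nlinarith) (by linarith) (by linarith) (by nlinarith)
    nlinarith
  have := le_of_mul_le_mul_right h0 (by linarith)
  linarith

lemma numeric_snd (hA : 4 ≤ A) (hAB : A ≤ B) (hBC : B ≤ C) (hk : 0 < k)
    (h : (k + C) * (A + B + C - 2) ≤ A * B * C) (hr : (A + B) * (r - 1) ≤ C - 2) :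
    2 * k ≤ (C - 2) * (B - 1 - r) := by
  by_cases hC : C - 2 < A + B
  · have hr1 : r ≤ 1 := by
      by_contra! hc
      nlinarith
    suffices 2 * k ≤ (C - 2) * (B - 2) by nlinarith
    by_cases h4 : C = 4
    · obtain rfl : B = 4 := by linarith
      obtain rfl : A = 4 := by linarith
      subst h4
      omega
    by_cases h5 : A = 5 ∧ C = 5
    · obtain ⟨rfl, rfl⟩ := h5
      obtain rfl : B = 5 := by linarith
      omega
    have h0 : (2 * k + 2 * C) * (A + B + C - 2) ≤
        ((C - 2) * (B - 2) + 2 * C) * (A + B + C - 2) := by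
      have h6 : (A + B + C - 2) * (2 * B - 4) ≤ B * C * (B + C - A - 2) := by
        by_cases hB : B < 6
        · have hC4 : 5 ≤ C := by omega
          have hB4 : 4 ≤ B := by omega
          interval_cases B
          · obtain rfl : A = 4 := by linarith
            nlinarith
          · rcases (show A = 4 ∨ A = 5 ∧ 6 ≤ C by omega) with rfl | ⟨rfl, hC6⟩ <;> nlinarith
        · calc (A + B + C - 2) * (2 * B - 4) ≤ (3 * C) * (2 * (C - 2)) :=
                mul_le_mul (by linarith) (by linarith) (by linarith) (by linarith)
            _ = 6 * C * (C - 2) := by ring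
            _ ≤ B * C * (B + C - A - 2) :=
                mul_le_mul (mul_le_mul_of_nonneg_right (by linarith) (by linarith))
                  (by linarith) (by linarith) (by nlinarith)
      nlinarith
    have := le_of_mul_le_mul_right h0 (by linarith)
    linarith
  · obtain ⟨S, rfl⟩ : ∃ S, B = S - A := ⟨A + B, by ring⟩
    obtain ⟨y, rfl⟩ : ∃ y, C = y + 2 := ⟨C - 2, by ring⟩
    have hS : 8 ≤ S := by linarith
    have hy : S ≤ y := by linarith
    have hAB' : 4 * (A * (S - A)) ≤ S * S := by nlinarith [sq_nonneg (S - 2 * A)]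
    have hyS : 4 * (S + y) ≤ S * S := by
      have h1 : (y + 2) * (S + y) ≤ (y + 2) * (A * (S - A)) := by nlinarith
      have := le_of_mul_le_mul_left h1 (by linarith)
      linarith
    have h1 : 4 * k * (S + y) ≤ S * S * (y + 2) - 4 * (y + 2) * (S + y) := by
      have := mul_le_mul_of_nonneg_right hAB' (show 0 ≤ y + 2 by linarith)
      nlinarith
    have h2 : 4 * (y * y * (S + y)) ≤ y * y * (S * S) := by
      have := mul_le_mul_of_nonneg_left hyS (mul_self_nonneg y)
      linarith
    have h3 : 4 * (S * S * S) ≤ S * S * (y * y) := by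
      have : 4 * S ≤ y * y := by nlinarith
      have := mul_le_mul_of_nonneg_left this (mul_self_nonneg S)
      linarith
    have h4 : (4 * k * S + 2 * (y * y)) * (S + y) ≤ y * S * (S - 4) * (S + y) := by
      have := mul_le_mul_of_nonneg_right h1 (show 0 ≤ S by linarith)
      nlinarith
    have h5 := le_of_mul_le_mul_right h4 (by linarith)
    have h6 : y * (S * (r - 1)) ≤ y * y := mul_le_mul_of_nonneg_left (by linarith) (by linarith)
    have h7 : S * (4 * k) ≤ S * (y * (S - 2 - 2 * r)) := by linarith
    have h8 := le_of_mul_le_mul_left h7 (by linarith)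
    nlinarith

/-- The numerical conditions needed for the coordinate version of the main theorem. -/
lemma exists_numerics {a b c k : ℕ} (ha : 2 < a) (hab : a ≤ b) (hbc : b ≤ c) (hk : 0 < k)
    (h : (k + (c + 1)) * (a + b + c + 1) ≤ (a + 1) * (b + 1) * (c + 1)) :
    ∃ P t₀ r, 2 * P ≤ c ∧ k ≤ P * t₀ ∧ t₀ < a + 1 ∧ k ≤ a * b + 1 ∧ 0 < r ∧ t₀ + r ≤ b ∧
      c ≤ r * (a + 1 + (b + 1)) ∧ k + (a + 1) + (b + 1) < (a + 1) * (b + 1) ∧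
      ∀ t ≤ t₀, k + r ≤ (a + 1 - t) * (b + 1 - t) + t / 2 * (a + 1 - t + (b + 1 - t)) + t := by
  obtain ⟨P, hP⟩ : ∃ P, P = c / 2 := ⟨_, rfl⟩
  have hP0 : 0 < P := by omega
  obtain ⟨t₀, ht₀⟩ : ∃ t₀, t₀ = (k + P - 1) / P := ⟨_, rfl⟩
  obtain ⟨r, hr⟩ : ∃ r, r = (c + (a + b + 2) - 1) / (a + b + 2) := ⟨_, rfl⟩
  have ht1 : P * t₀ ≤ k + P - 1 := ht₀ ▸ Nat.mul_div_le _ _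
  have ht2 : k + P - 1 < P * t₀ + P := by
    have := Nat.lt_mul_div_succ (k + P - 1) hP0
    rwa [← ht₀, mul_add, mul_one] at this
  have hr1 : (a + b + 2) * r ≤ c + (a + b + 2) - 1 := hr ▸ Nat.mul_div_le _ _
  have hr2 : c + (a + b + 2) - 1 < (a + b + 2) * r + (a + b + 2) := by
    have := Nat.lt_mul_div_succ (c + (a + b + 2) - 1) (show 0 < a + b + 2 by omega)
    rwa [← hr, mul_add, mul_one] at this
  have hr0 : 0 < r := Nat.pos_of_ne_zero fun h => by subst h; omega
  have hA : (4 : ℤ) ≤ (a : ℤ) + 1 := by omega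
  have hAB : (a : ℤ) + 1 ≤ (b : ℤ) + 1 := by omega
  have hBC : (b : ℤ) + 1 ≤ (c : ℤ) + 1 := by omega
  have hmain : ((k : ℤ) + ((c : ℤ) + 1)) * (((a : ℤ) + 1) + ((b : ℤ) + 1) + ((c : ℤ) + 1) - 2) ≤
      ((a : ℤ) + 1) * ((b : ℤ) + 1) * ((c : ℤ) + 1) := by
    have : ((k : ℤ) + (c + 1)) * (a + b + c + 1) ≤ (a + 1) * (b + 1) * (c + 1) := by
      exact_mod_cast h
    linarith
  have hrS : (((a : ℤ) + 1) + ((b : ℤ) + 1)) * ((r : ℤ) - 1) ≤ ((c : ℤ) + 1) - 2 := by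
    have : ((a : ℤ) + b + 2) * r + 1 ≤ c + (a + b + 2) := by
      have : (a + b + 2) * r + 1 ≤ c + (a + b + 2) := by omega
      exact_mod_cast this
    linarith
  have htri := numeric_trisecant hA hAB hBC hmain
  have hfst := numeric_fst hA hAB hBC hmain
  have hsnd := numeric_snd hA hAB hBC (by exact_mod_cast hk) hmain hrS
  have hPt : (P : ℤ) * t₀ + 1 ≤ k + P := by
    have : P * t₀ + 1 ≤ k + P := by omega
    exact_mod_cast this
  have hPc : (c : ℤ) + 1 - 2 ≤ 2 * P := by omega
  have hta : t₀ < a + 1 := by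
    have h1 : (P : ℤ) * t₀ < P * (a + 1) := by nlinarith
    exact_mod_cast lt_of_mul_lt_mul_left h1 (by positivity)
  have htb : t₀ + r ≤ b := by
    have h0 : (0 : ℤ) < (b : ℤ) + 1 - 1 - r := by
      by_contra! hc
      have := mul_nonpos_of_nonneg_of_nonpos (show (0 : ℤ) ≤ (c : ℤ) + 1 - 2 by omega) hc
      omega
    have h2 := mul_le_mul_of_nonneg_right hPc h0.le
    have h1 : (P : ℤ) * t₀ < P * (b - r + 1) := by nlinarith
    have := lt_of_mul_lt_mul_left h1 (by positivity)
    omega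
  refine ⟨P, t₀, r, by omega, by omega, hta, ?_, hr0, htb, ?_, ?_, fun t ht => ?_⟩
  · zify
    linarith
  · have : a + 1 + (b + 1) = a + b + 2 := by ring
    rw [this, mul_comm]
    omega
  · zify
    linarith
  · have hts : ((c : ℤ) + 1 - 2) * ((t : ℤ) - 1) ≤ 2 * ((k : ℤ) - 1) := by
      by_cases h0 : t = 0
      · subst h0
        push_cast
        omega
      · have h1 : ((c : ℤ) + 1 - 2) * ((t : ℤ) - 1) ≤ 2 * P * (t₀ - 1) :=
          mul_le_mul hPc (by omega) (by omega) (by positivity)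
        linarith
    have key := numeric_tangent hA hAB hBC hmain hts hrS
    zify [show t ≤ a + 1 by omega, show t ≤ b + 1 by omega]
    have ha' : (t : ℤ) ≤ a := by omega
    have hb' : (t : ℤ) ≤ b := by omega
    rcases Nat.even_or_odd' t with ⟨m, rfl | rfl⟩
    · rw [show ((2 * m : ℕ) : ℤ) / 2 = m by omega]
      push_cast at key ha' hb' ⊢
      linarith
    · rw [show ((2 * m + 1 : ℕ) : ℤ) / 2 = m by omega]
      push_cast at key ha' hb' ⊢
      linarith

end Numerics

section Transfer

variable {a b c k e : ℕ}

/-- Multi-indices for three factors as triples. -/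
def tripleEquiv (a b c : ℕ) : BIdx 3 ![a, b, c] ≃ Fin (a + 1) × Fin (b + 1) × Fin (c + 1) where
  toFun f := (f 0, f 1, f 2)
  invFun q j := match j with
    | 0 => q.1
    | 1 => q.2.1
    | 2 => q.2.2
  left_inv f := by
    funext j
    fin_cases j <;> rfl
  right_inv _ := rfl

/-- Coordinates on the space of tensors with three factors. -/
def tenCoord (a b c : ℕ) :
    Ten 3 ![a, b, c] ≃ₗ[ℂ] (Fin (a + 1) × Fin (b + 1) × Fin (c + 1) → ℂ) :=
  (Basis.piTensorProduct fun j => Pi.basisFun ℂ (Fin (![a, b, c] j + 1))).equivFun.trans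
    (LinearEquiv.funCongrLeft ℂ ℂ (tripleEquiv a b c).symm)

lemma tenCoord_tprod (v : ∀ j : Fin 3, Fin (![a, b, c] j + 1) → ℂ) :
    tenCoord a b c (tprod ℂ v) = ten (v 0) (v 1) (v 2) := by
  ext q
  simp [tenCoord, LinearEquiv.funCongrLeft_apply, Basis.piTensorProduct_repr_tprod_apply,
    Fin.prod_univ_three, ten]
  rfl

lemma tenCoord_fromCoords (f : BIdx 3 ![a, b, c] → ℂ) :
    tenCoord a b c (fromCoords ![a, b, c] f) = fun q => f ((tripleEquiv a b c).symm q) := by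
  have : fromCoords ![a, b, c] f =
      (Basis.piTensorProduct fun j => Pi.basisFun ℂ (Fin (![a, b, c] j + 1))).equivFun.symm f := by
    rw [Module.Basis.equivFun_symm_apply]
    refine Finset.sum_congr rfl fun g _ => ?_
    rw [basisVec, Basis.piTensorProduct_apply]
    simp
  rw [this, tenCoord, LinearEquiv.trans_apply, LinearEquiv.apply_symm_apply]
  rfl

/-- The renaming of the coordinates on the parameter space. -/
def parIndex (a b c k e : ℕ) :
    ParExt (Fin k) (Fin (a + 1)) (Fin (b + 1)) (Fin (c + 1)) (Fin e) →
      WIdx 3 ![a, b, c] k ⊕ (Fin e × BIdx 3 ![a, b, c]) :=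
  Sum.map (fun q => (q.1, Sum.elim (fun n => ⟨0, n⟩) (Sum.elim (fun n => ⟨1, n⟩)
    (fun n => ⟨2, n⟩)) q.2)) (Prod.map id (tripleEquiv a b c).symm)

lemma parIndex_injective : Function.Injective (parIndex a b c k e) := by
  refine Sum.map_injective.2 ⟨?_, Function.injective_id.prodMap (Equiv.injective _)⟩
  rintro ⟨i, n | n | n⟩ ⟨j, m | m | m⟩ h <;> obtain ⟨rfl, h⟩ := Prod.mk.inj h <;>
    obtain ⟨h, h'⟩ := Sigma.mk.inj h
  all_goals first
    | exact absurd h (by decide)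
    | rw [eq_of_heq h']

variable (p : Fin k → ∀ j : Fin 3, Fin (![a, b, c] j + 1) → ℂ)
  (f : Fin e → BIdx 3 ![a, b, c] → ℂ)

/-- The point of the parameter space in the coordinates of `ParExt`. -/
def parPoint : ParExt (Fin k) (Fin (a + 1)) (Fin (b + 1)) (Fin (c + 1)) (Fin e) → ℂ :=
  fun i => Sum.elim (fun x => p x.1 x.2.1 x.2.2) (fun y => f y.1 y.2) (parIndex a b c k e i)

lemma ext_parPoint (m : Fin e) :
    ext (parPoint p f) m = tenCoord a b c (fromCoords ![a, b, c] (f m)) := by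
  rw [tenCoord_fromCoords]
  rfl

/-- The parametrization of the span of the tangent spaces and the extra tensors, as a linear
map. -/
def extLin {κ α β γ ε : Type*} [Fintype κ] [Fintype α] [Fintype β] [Fintype ε]
    (s : ParExt κ α β γ ε → ℂ) : TanCoord κ α β γ × (ε → ℂ) →ₗ[ℂ] (α × β × γ → ℂ) where
  toFun v := extMap s v.1 v.2
  map_add' v v' := extMap_add s v.1 v'.1 v.2 v'.2
  map_smul' u v := extMap_smul s u v.1 v.2

lemma mem_tangent (w : ∀ j : Fin 3, Fin (![a, b, c] j + 1) → ℂ) (j : Fin 3)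
    (u : Fin (![a, b, c] j + 1) → ℂ) : tprod ℂ (Function.update w j u) ∈ tangent ![a, b, c] w :=
  Submodule.subset_span ⟨j, u, rfl⟩

lemma ten_congr {α β γ : Type*} {x x' : α → ℂ} {y y' : β → ℂ} {z z' : γ → ℂ} (hx : x = x')
    (hy : y = y') (hz : z = z') : ten x y z = ten x' y' z' := by
  rw [hx, hy, hz]

lemma tenCoord_update_fst (w : ∀ j : Fin 3, Fin (![a, b, c] j + 1) → ℂ) (u : Fin (a + 1) → ℂ) :
    tenCoord a b c (tprod ℂ (Function.update w 0 u)) = ten u (w 1) (w 2) :=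
  (tenCoord_tprod _).trans <| ten_congr
    (Function.update_self ..)
    (Function.update_of_ne (by decide) ..)
    (Function.update_of_ne (by decide) ..)

lemma tenCoord_update_snd (w : ∀ j : Fin 3, Fin (![a, b, c] j + 1) → ℂ) (u : Fin (b + 1) → ℂ) :
    tenCoord a b c (tprod ℂ (Function.update w 1 u)) = ten (w 0) u (w 2) :=
  (tenCoord_tprod _).trans <| ten_congr
    (Function.update_of_ne (by decide) ..)
    (Function.update_self ..)
    (Function.update_of_ne (by decide) ..)

lemma tenCoord_update_trd (w : ∀ j : Fin 3, Fin (![a, b, c] j + 1) → ℂ) (u : Fin (c + 1) → ℂ) :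
    tenCoord a b c (tprod ℂ (Function.update w 2 u)) = ten (w 0) (w 1) u :=
  (tenCoord_tprod _).trans <| ten_congr
    (Function.update_of_ne (by decide) ..)
    (Function.update_of_ne (by decide) ..)
    (Function.update_self ..)

lemma map_tenCoord (h : ∀ i, ∑ n, px (pts (parPoint p f)) i n ≠ 0 ∧
      ∑ n, py (pts (parPoint p f)) i n ≠ 0) :
    ((⨆ i, tangent ![a, b, c] (p i)) ⊔
      Submodule.span ℂ (Set.range fun m => fromCoords ![a, b, c] (f m))).map
        (tenCoord a b c).toLinearMap = LinearMap.range (extLin (parPoint p f)) := by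
  classical
  have htan {v} (hv : ∃ τ, tanMap (px (pts (parPoint p f))) (py (pts (parPoint p f)))
      (pz (pts (parPoint p f))) τ = v) : v ∈ LinearMap.range (extLin (parPoint p f)) := by
    obtain ⟨τ, rfl⟩ := hv
    exact ⟨(τ, 0), by simp [extLin, extMap]⟩
  apply le_antisymm
  · rw [Submodule.map_le_iff_le_comap, sup_le_iff, iSup_le_iff]
    refine ⟨fun i => Submodule.span_le.2 ?_, Submodule.span_le.2 ?_⟩
    · rintro _ ⟨j, u, rfl⟩
      change tenCoord a b c _ ∈ LinearMap.range (extLin (parPoint p f))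
      match j, u with
      | 0, u => exact htan ((exists_tanMap_eq_fst _ _ _ i (h i).1 u).imp fun _ hτ =>
          hτ.trans (tenCoord_update_fst (p i) u).symm)
      | 1, u => exact htan ((exists_tanMap_eq_snd _ _ _ i (h i).2 u).imp fun _ hτ =>
          hτ.trans (tenCoord_update_snd (p i) u).symm)
      | 2, u =>
        refine htan ⟨Pi.single i (u, 0, 0), Eq.trans ?_ (tenCoord_update_trd (p i) u).symm⟩
        rw [tanMap_single]
        ext q
        simp [ten]
        exact Or.inl rfl
    · rintro _ ⟨m, rfl⟩
      refine ⟨(0, Pi.single m 1), ?_⟩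
      simp only [extLin, LinearMap.coe_mk, AddHom.coe_mk, extMap, map_zero, zero_add]
      rw [Finset.sum_eq_single m (fun j _ hj => by rw [Pi.single_eq_of_ne hj, zero_smul])
        (by simp), Pi.single_eq_same, one_smul, ext_parPoint]
      rfl
  · rintro _ ⟨⟨τ, μ⟩, rfl⟩
    have hmem {i t} (ht : t ∈ tangent ![a, b, c] (p i)) := Submodule.mem_map_of_mem
      (f := (tenCoord a b c).toLinearMap) (Submodule.mem_sup_left
        (T := Submodule.span ℂ (Set.range fun m => fromCoords ![a, b, c] (f m)))
        (Submodule.mem_iSup_of_mem (p := fun i => tangent ![a, b, c] (p i)) i ht))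
    refine Submodule.add_mem _ ?_ (Submodule.sum_mem _ fun m _ => Submodule.smul_mem _ _ ?_)
    · have : τ = ∑ i, Pi.single i (τ i) := (Finset.univ_sum_single τ).symm
      rw [this, map_sum]
      refine Submodule.sum_mem _ fun i _ => ?_
      rw [tanMap_single]
      refine Submodule.add_mem _ (Submodule.add_mem _ ?_ ?_) ?_
      · exact tenCoord_update_trd (p i) (τ i).1 ▸ hmem (mem_tangent (p i) 2 _)
      · exact tenCoord_update_snd (p i) (τ i).2.1 ▸ hmem (mem_tangent (p i) 1 _)
      · exact tenCoord_update_fst (p i) (τ i).2.2 ▸ hmem (mem_tangent (p i) 0 _)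
    · rw [ext_parPoint]
      exact Submodule.mem_map_of_mem (f := (tenCoord a b c).toLinearMap)
        (Submodule.mem_sup_right (Submodule.subset_span ⟨m, rfl⟩))

end Transfer

end SegreTangent

open SegreTangent

/-- generalized Strassen theorem: tangential generality in
codimension `a + b + 2` for `ℙ^a × ℙ^b × ℙ^c`, `2 < a ≤ b ≤ c`. -/
theorem stmt_11 (a b c : ℕ) (ha : 2 < a) (hab : a ≤ b) (hbc : b ≤ c)
    (k : ℕ) (hk : 0 < k)
    (hkb : (k : ℚ) ≤ ((a : ℚ) + 1) * ((b : ℚ) + 1) * ((c : ℚ) + 1) /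
      ((a : ℚ) + b + c + 1) - c - 1) :
    TangentGeneral 3 ![a, b, c] k ((a + 1) * (b + 1) * (c + 1) - (a + b + 2)) := by
  have hD : (0 : ℚ) < (a : ℚ) + b + c + 1 := by positivity
  have h : (k + (c + 1)) * (a + b + c + 1) ≤ (a + 1) * (b + 1) * (c + 1) := by
    have h' : (k : ℚ) + (c + 1) ≤ (a + 1) * (b + 1) * (c + 1) / (a + b + c + 1) := by linarith
    rw [le_div_iff₀ hD] at h'
    exact_mod_cast h'
  obtain ⟨P, t₀, r, hP, hkP, hA, hkab, hr, hrb, hrc, htri, hcard⟩ :=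
    exists_numerics ha hab hbc hk h
  have hsum : 1 + ∑ j, ![a, b, c] j = a + b + c + 1 := by
    rw [Fin.sum_univ_three]
    simp only [Matrix.cons_val]
    ring
  have hdim := finrank_tanCoord (κ := Fin k) (α := Fin (a + 1)) (β := Fin (b + 1))
    (γ := Fin (c + 1))
  simp only [Fintype.card_fin] at hdim
  have hdim' : Module.finrank ℂ (TanCoord (Fin k) (Fin (a + 1)) (Fin (b + 1)) (Fin (c + 1))) =
      k * (1 + ∑ j, ![a, b, c] j) := by
    rw [hsum]
    linarith
  have hle : k * (1 + ∑ j, ![a, b, c] j) + (a + b + 2) ≤ (a + 1) * (b + 1) * (c + 1) := by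
    rw [hsum]
    nlinarith
  obtain ⟨F, hF, hgen⟩ := (gen_tangent
    (e := (a + 1) * (b + 1) * (c + 1) - (a + b + 2) - k * (1 + ∑ j, ![a, b, c] j))
    hk hP hkP hA hkab hr hrb hrc hcard htri (by rw [hdim', ← mul_assoc]; omega)).comap _
    parIndex_injective
  refine ⟨F, ?_, fun p f hpf => ?_⟩
  · obtain ⟨s, hs⟩ := exists_eval_ne_zero hF
    refine ⟨fun i j n => s (.inl (i, ⟨j, n⟩)), fun m g => s (.inr (m, g)), ?_⟩
    rw [evalWV]
    convert hs
    ext (x | x) <;> rfl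
  obtain ⟨hne, hinj, htan⟩ := hgen _ hpf
  have hmap := map_tenCoord p f hne
  have hker : Function.Injective (extLin (parPoint p f)) :=
    (injective_iff_map_eq_zero _).2 fun v hv => Prod.ext (hinj _ _ hv).1 (hinj _ _ hv).2
  refine ⟨?_, fun w hw hwL => ?_⟩
  · rw [← LinearEquiv.finrank_map_eq (tenCoord a b c), hmap, LinearMap.finrank_range_of_inj hker,
      Module.finrank_prod, hdim', Module.finrank_fin_fun]
    exact Nat.add_sub_of_le (Nat.le_sub_of_add_le hle)
  · have hmem (j u) : tenCoord a b c (tprod ℂ (Function.update w j u)) ∈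
        LinearMap.range (extLin (parPoint p f)) :=
      hmap ▸ Submodule.mem_map_of_mem (hwL (mem_tangent w j u))
    obtain ⟨i, t, ht⟩ := htan (w 0) (w 1) (w 2) (hw 0) (hw 1)
      (fun v => by
        obtain ⟨⟨τ, μ⟩, hv⟩ := hmem 2 v
        exact ⟨τ, μ, (hv.trans (tenCoord_update_trd w v)).symm⟩)
      (fun v => by
        obtain ⟨⟨τ, μ⟩, hv⟩ := hmem 1 v
        exact ⟨τ, μ, (hv.trans (tenCoord_update_snd w v)).symm⟩)
    refine ⟨i, t, (tenCoord a b c).injective ?_⟩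
    rw [map_smul, tenCoord_tprod, tenCoord_tprod]
    exact ht
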